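/- arXiv:2005.06134 — 7 statements merged into one kernel-verified Lean document; each statement's English description precedes it below -/
import Mathlib

section
/- Let n be a positive integer, R an n×n real symmetric positive definite matrix, and φ:[a,b]→ℝⁿ a continuous function. Define F₀=∫_a^b φ(u)w(u)du, F_i=∫_a^b p_i(u)φ(u)w(u)du for i=1,2,3, q₀=∫_a^b w(u)du, q_i=∫_a^b p_i(u)²w(u)du for i=1,2,3, and q₁₃=∫_a^b p₁(u)p₃(u)w(u)du. Then ∫_a^b φ(u)ᵀRφ(u)w(u)du ≥ (1/q₀)F₀ᵀRF₀ + (1/q₁)F₁ᵀRF₁ + (1/q₂)F₂ᵀRF₂ + (1/q₃)(F₃ − (q₁₃/q₁)F₁)ᵀR(F₃ − (q₁₃/q₁)F₁). -/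
open Matrix intervalIntegral

open MeasureTheory

/-- Bessel's inequality for a finite orthogonal family whose squared norms are only bounded above. -/
theorem sum_sq_integral_mul_div_le {α ι : Type*} [Fintype ι] [MeasurableSpace α]
    {ν : Measure α} {e : ι → α → ℝ} {f : α → ℝ} {q : ι → ℝ}
    (he : ∀ i, MemLp (e i) 2 ν) (hf : MemLp f 2 ν)
    (horth : ∀ i j, i ≠ j → ∫ u, e i u * e j u ∂ν = 0)
    (hq : ∀ i, 0 < q i) (hle : ∀ i, ∫ u, e i u * e i u ∂ν ≤ q i) :
    ∑ i, (1 / q i) * ((∫ u, e i u * f u ∂ν) * ∫ u, e i u * f u ∂ν) ≤ ∫ u, f u * f u ∂ν := by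
  let c : ι → ℝ := fun i => (∫ u, e i u * f u ∂ν) / q i
  have hee (i j : ι) : Integrable (fun u => c i * c j * (e i u * e j u)) ν :=
    ((he i).integrable_mul (he j)).const_mul _
  have hef (i : ι) : Integrable (fun u => 2 * c i * (e i u * f u)) ν :=
    ((he i).integrable_mul hf).const_mul _
  have hff : Integrable (fun u => f u * f u) ν := hf.integrable_mul hf
  have hexpand : ∫ u, (f u - ∑ i, c i * e i u) ^ 2 ∂ν =
      ∫ u, f u * f u ∂ν - ∑ i, 2 * c i * ∫ u, e i u * f u ∂ν
        + ∑ i, ∑ j, c i * c j * ∫ u, e i u * e j u ∂ν := by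
    have hpt : ∀ u, (f u - ∑ i, c i * e i u) ^ 2 =
        f u * f u - ∑ i, 2 * c i * (e i u * f u)
          + ∑ i, ∑ j, c i * c j * (e i u * e j u) := by
      intro u
      have hcross : ∑ i, 2 * c i * (e i u * f u) = 2 * f u * ∑ i, c i * e i u := by
        rw [Finset.mul_sum]
        exact Finset.sum_congr rfl fun i _ => by ring
      have hsq : ∑ i, ∑ j, c i * c j * (e i u * e j u) =
          (∑ i, c i * e i u) * ∑ i, c i * e i u := by
        rw [Finset.sum_mul_sum]
        exact Finset.sum_congr rfl fun i _ => Finset.sum_congr rfl fun j _ => by ring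
      rw [hcross, hsq]
      ring
    simp_rw [hpt]
    have hsum_ef := integrable_finsetSum Finset.univ fun i _ => hef i
    have hsum_ee (i : ι) := integrable_finsetSum Finset.univ fun j _ => hee i j
    rw [integral_add (hff.sub' hsum_ef) (integrable_finsetSum _ fun i _ => hsum_ee i),
      integral_sub hff hsum_ef, integral_finsetSum _ fun i _ => hef i,
      integral_finsetSum _ fun i _ => hsum_ee i]
    simp_rw [integral_finsetSum Finset.univ fun j _ => hee _ j, MeasureTheory.integral_const_mul]
  have hdiag (i : ι) : ∑ j, c i * c j * ∫ u, e i u * e j u ∂ν =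
      c i * c i * ∫ u, e i u * e i u ∂ν :=
    Finset.sum_eq_single i (fun j _ hj => by rw [horth i j hj.symm, mul_zero]) (by simp)
  have hnonneg : 0 ≤ ∫ u, (f u - ∑ i, c i * e i u) ^ 2 ∂ν :=
    integral_nonneg fun u => sq_nonneg _
  rw [hexpand, Finset.sum_congr rfl fun i _ => hdiag i] at hnonneg
  have hterm : ∑ i, (1 / q i) * ((∫ u, e i u * f u ∂ν) * ∫ u, e i u * f u ∂ν) ≤
      ∑ i, 2 * c i * (∫ u, e i u * f u ∂ν) - ∑ i, c i * c i * ∫ u, e i u * e i u ∂ν := by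
    rw [← Finset.sum_sub_distrib]
    refine Finset.sum_le_sum fun i _ => ?_
    have hcoef : ∫ u, e i u * f u ∂ν = c i * q i := (div_mul_cancel₀ _ (hq i).ne').symm
    have hlhs : (1 / q i) * (c i * q i * (c i * q i)) = c i * c i * q i := by
      field_simp [(hq i).ne']
    rw [hcoef, hlhs]
    nlinarith [mul_le_mul_of_nonneg_left (hle i) (mul_self_nonneg (c i))]
  linarith

/-- Bessel's inequality for vector-valued functions, measured by a positive semidefinite form. -/
theorem sum_quadForm_integral_smul_le {α ι m : Type*} [Fintype ι] [Fintype m]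
    [MeasurableSpace α] {ν : Measure α} {e : ι → α → ℝ} {φ : α → m → ℝ} {q : ι → ℝ}
    {R : Matrix m m ℝ} (hR : R.PosSemidef)
    (he : ∀ i, MemLp (e i) 2 ν) (hφ : MemLp φ 2 ν)
    (horth : ∀ i j, i ≠ j → ∫ u, e i u * e j u ∂ν = 0)
    (hq : ∀ i, 0 < q i) (hle : ∀ i, ∫ u, e i u * e i u ∂ν ≤ q i) :
    ∑ i, (1 / q i) * ((∫ u, e i u • φ u ∂ν) ⬝ᵥ R *ᵥ ∫ u, e i u • φ u ∂ν) ≤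
      ∫ u, φ u ⬝ᵥ R *ᵥ φ u ∂ν := by
  classical
  obtain ⟨B, rfl⟩ : ∃ B : Matrix m m ℝ, R = Bᴴ * B := by
    open scoped MatrixOrder in
    exact CStarAlgebra.nonneg_iff_eq_star_mul_self.mp hR.nonneg
  have hform (x : m → ℝ) : x ⬝ᵥ (Bᴴ * B) *ᵥ x = ∑ k, (B *ᵥ x) k * (B *ᵥ x) k := by
    rw [← Matrix.mulVec_mulVec, Matrix.dotProduct_mulVec,
      Matrix.conjTranspose_eq_transpose_of_trivial, Matrix.vecMul_transpose, dotProduct]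
  let L (k : m) : (m → ℝ) →L[ℝ] ℝ :=
    (ContinuousLinearMap.proj k).comp (Matrix.mulVecLin B).toContinuousLinearMap
  have hL (k : m) : MemLp (fun u => (B *ᵥ φ u) k) 2 ν := (L k).comp_memLp' hφ
  have hLL (k : m) : Integrable (fun u => (B *ᵥ φ u) k * (B *ᵥ φ u) k) ν :=
    (hL k).integrable_mul (hL k)
  have hintegral (i : ι) (k : m) :
      (B *ᵥ ∫ u, e i u • φ u ∂ν) k = ∫ u, e i u * (B *ᵥ φ u) k ∂ν := by
    have hcomm := (L k).integral_comp_comm (φ := fun u => e i u • φ u)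
      (memLp_one_iff_integrable.mp (hφ.smul (he i)))
    simpa [L, Matrix.mulVec_smul] using hcomm.symm
  simp_rw [hform, hintegral]
  rw [integral_finsetSum _ fun k _ => hLL k]
  simp_rw [Finset.mul_sum]
  rw [Finset.sum_comm]
  exact Finset.sum_le_sum fun k _ => sum_sq_integral_mul_div_le he (hL k) horth hq hle

/-- Integrating against the measure `w(u) du` on `(a, b]` is integrating with weight `w`. -/
theorem integral_withDensity_ofReal_Ioc {E : Type*} [NormedAddCommGroup E] [NormedSpace ℝ E]
    {a b : ℝ} (hab : a ≤ b) {w : ℝ → ℝ} (hw : ContinuousOn w (Set.Icc a b))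
    (hw0 : ∀ u ∈ Set.Icc a b, 0 ≤ w u) (g : ℝ → E) :
    ∫ u, g u ∂(volume.restrict (Set.Ioc a b)).withDensity (fun u => ENNReal.ofReal (w u)) =
      ∫ u in a..b, w u • g u := by
  have hmeas : AEMeasurable w (volume.restrict (Set.Ioc a b)) :=
    (hw.mono Set.Ioc_subset_Icc_self).aemeasurable measurableSet_Ioc
  rw [integral_withDensity_eq_integral_toReal_smul₀ hmeas.ennreal_ofReal
    (ae_of_all _ fun u => ENNReal.ofReal_lt_top), intervalIntegral.integral_of_le hab]
  refine setIntegral_congr_fun measurableSet_Ioc fun u hu => ?_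
  simp only [ENNReal.toReal_ofReal (hw0 u (Set.Ioc_subset_Icc_self hu))]

/-- The Bessel-type inequality for the constant function and three functions of mean zero, of
which only the first and the third may fail to be orthogonal. The component of `p3` along `p1` is
removed to make the family orthogonal. -/
theorem quadForm_integral_smul_add_le {α m : Type*} [Fintype m] [MeasurableSpace α]
    {ν : Measure α} [IsFiniteMeasure ν] {p1 p2 p3 : α → ℝ} {φ : α → m → ℝ}
    {q0 q1 q2 q3 q13 : ℝ} {R : Matrix m m ℝ} (hR : R.PosSemidef)
    (h1 : MemLp p1 2 ν) (h2 : MemLp p2 2 ν) (h3 : MemLp p3 2 ν) (hφ : MemLp φ 2 ν)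
    (horth1 : ∫ u, p1 u ∂ν = 0) (horth2 : ∫ u, p2 u ∂ν = 0) (horth3 : ∫ u, p3 u ∂ν = 0)
    (h12 : ∫ u, p1 u * p2 u ∂ν = 0) (h23 : ∫ u, p2 u * p3 u ∂ν = 0)
    (h13 : ∫ u, p1 u * p3 u ∂ν = q13)
    (h00 : ∫ _, (1 : ℝ) * 1 ∂ν = q0) (h11 : ∫ u, p1 u * p1 u ∂ν = q1)
    (h22 : ∫ u, p2 u * p2 u ∂ν = q2) (h33 : ∫ u, p3 u * p3 u ∂ν = q3)
    (hq0pos : 0 < q0) (hq1pos : 0 < q1) (hq2pos : 0 < q2) (hq3pos : 0 < q3)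
    {F0 F1 F2 F3 : m → ℝ} (hF0 : ∫ u, φ u ∂ν = F0) (hF1 : ∫ u, p1 u • φ u ∂ν = F1)
    (hF2 : ∫ u, p2 u • φ u ∂ν = F2) (hF3 : ∫ u, p3 u • φ u ∂ν = F3) :
    (1 / q0) * (F0 ⬝ᵥ R *ᵥ F0) + (1 / q1) * (F1 ⬝ᵥ R *ᵥ F1) + (1 / q2) * (F2 ⬝ᵥ R *ᵥ F2) +
      (1 / q3) * ((F3 - (q13 / q1) • F1) ⬝ᵥ R *ᵥ (F3 - (q13 / q1) • F1)) ≤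
      ∫ u, φ u ⬝ᵥ R *ᵥ φ u ∂ν := by
  set c : ℝ := q13 / q1
  have hcq : c * q1 = q13 := div_mul_cancel₀ _ hq1pos.ne'
  let e : Fin 4 → α → ℝ := ![fun _ => 1, p1, p2, fun u => p3 u - c * p1 u]
  have hr : MemLp (fun u => p3 u - c * p1 u) 2 ν := h3.sub (h1.const_mul c)
  have he : ∀ i, MemLp (e i) 2 ν := by
    intro i
    fin_cases i
    exacts [memLp_const 1, h1, h2, hr]
  have hresid {g : α → ℝ} (hg : MemLp g 2 ν) : ∫ u, g u * (p3 u - c * p1 u) ∂ν =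
      ∫ u, g u * p3 u ∂ν - c * ∫ u, g u * p1 u ∂ν := by
    have hg3 : Integrable (fun u => g u * p3 u) ν := hg.integrable_mul h3
    have hg1 : Integrable (fun u => c * (g u * p1 u)) ν := (hg.integrable_mul h1).const_mul c
    rw [← MeasureTheory.integral_const_mul, ← MeasureTheory.integral_sub hg3 hg1]
    congr with u
    ring
  have h21 : ∫ u, p2 u * p1 u ∂ν = 0 := by simpa only [mul_comm] using h12
  have h31 : ∫ u, p3 u * p1 u ∂ν = q13 := by simpa only [mul_comm] using h13
  have hlt : ∀ i j, i < j → ∫ u, e i u * e j u ∂ν = 0 := by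
    have h01 : ∫ u, 1 * p1 u ∂ν = 0 := by simpa only [one_mul] using horth1
    have h02 : ∫ u, 1 * p2 u ∂ν = 0 := by simpa only [one_mul] using horth2
    have h03 : ∫ u, 1 * p3 u ∂ν = 0 := by simpa only [one_mul] using horth3
    have h0r : ∫ u, 1 * (p3 u - c * p1 u) ∂ν = 0 := by
      rw [hresid (memLp_const 1), h03, h01, mul_zero, sub_zero]
    have h1r : ∫ u, p1 u * (p3 u - c * p1 u) ∂ν = 0 := by
      rw [hresid h1, h13, h11, hcq, sub_self]
    have h2r : ∫ u, p2 u * (p3 u - c * p1 u) ∂ν = 0 := by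
      rw [hresid h2, h23, h21, mul_zero, sub_zero]
    intro i j hij
    fin_cases i <;> fin_cases j <;> first | exact absurd hij (by decide) | assumption
  have horth' : ∀ i j, i ≠ j → ∫ u, e i u * e j u ∂ν = 0 := by
    intro i j hij
    rcases hij.lt_or_gt with h | h
    · exact hlt i j h
    · simpa only [mul_comm] using hlt j i h
  have hrr : ∫ u, (p3 u - c * p1 u) * (p3 u - c * p1 u) ∂ν ≤ q3 := by
    have hcomm (g : α → ℝ) : ∫ u, (p3 u - c * p1 u) * g u ∂ν =
        ∫ u, g u * (p3 u - c * p1 u) ∂ν := by simp only [mul_comm]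
    rw [hresid hr, hcomm, hcomm, hresid h3, hresid h1, h33, h31, h13, h11,
      ← hcq]
    nlinarith [mul_nonneg (mul_self_nonneg c) hq1pos.le]
  have hbessel := sum_quadForm_integral_smul_le (q := ![q0, q1, q2, q3]) hR he hφ horth'
    (by
      intro i
      fin_cases i
      exacts [hq0pos, hq1pos, hq2pos, hq3pos])
    (by
      intro i
      fin_cases i
      exacts [h00.le, h11.le, h22.le, hrr])
  have hFr : ∫ u, (p3 u - c * p1 u) • φ u ∂ν =
      ∫ u, p3 u • φ u ∂ν - c • ∫ u, p1 u • φ u ∂ν := by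
    have hintegral {p : α → ℝ} (hp : MemLp p 2 ν) : Integrable (fun u => p u • φ u) ν :=
      memLp_one_iff_integrable.mp (hφ.smul hp)
    rw [← MeasureTheory.integral_smul,
      ← MeasureTheory.integral_sub (hintegral h3) ((hintegral h1).fun_smul c)]
    simp only [sub_smul, mul_smul]
  have hF0' : ∫ u, (1 : ℝ) • φ u ∂ν = F0 := by simpa only [one_smul] using hF0
  rw [hF1, hF3] at hFr
  rw [Fin.sum_univ_four] at hbessel
  change (1 / q0) * ((∫ u, (1 : ℝ) • φ u ∂ν) ⬝ᵥ R *ᵥ ∫ u, (1 : ℝ) • φ u ∂ν) +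
    (1 / q1) * ((∫ u, p1 u • φ u ∂ν) ⬝ᵥ R *ᵥ ∫ u, p1 u • φ u ∂ν) +
    (1 / q2) * ((∫ u, p2 u • φ u ∂ν) ⬝ᵥ R *ᵥ ∫ u, p2 u • φ u ∂ν) +
    (1 / q3) * ((∫ u, (p3 u - c * p1 u) • φ u ∂ν) ⬝ᵥ
      R *ᵥ ∫ u, (p3 u - c * p1 u) • φ u ∂ν) ≤ _ at hbessel
  rwa [hF0', hF1, hF2, hFr] at hbessel

theorem weighted_integral_inequality
    {n : ℕ} (hn : 0 < n)
    (a b : ℝ) (hab : a < b)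
    (w p1 p2 p3 : ℝ → ℝ)
    (hw : ContinuousOn w (Set.Icc a b))
    (hwpos : ∀ u ∈ Set.Icc a b, 0 < w u)
    (hp1 : ContinuousOn p1 (Set.Icc a b))
    (hp2 : ContinuousOn p2 (Set.Icc a b))
    (hp3meas : Measurable p3)
    (hp3bdd : ∃ M : ℝ, ∀ u ∈ Set.Icc a b, |p3 u| ≤ M)
    (horth1 : (∫ u in a..b, p1 u * w u) = 0)
    (horth2 : (∫ u in a..b, p2 u * w u) = 0)
    (horth3 : (∫ u in a..b, p3 u * w u) = 0)
    (horth12 : (∫ u in a..b, p1 u * p2 u * w u) = 0)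
    (horth23 : (∫ u in a..b, p2 u * p3 u * w u) = 0)
    (q0 q1 q2 q3 q13 : ℝ)
    (hq0 : q0 = ∫ u in a..b, w u)
    (hq1 : q1 = ∫ u in a..b, (p1 u)^2 * w u)
    (hq2 : q2 = ∫ u in a..b, (p2 u)^2 * w u)
    (hq3 : q3 = ∫ u in a..b, (p3 u)^2 * w u)
    (hq1pos : 0 < q1) (hq2pos : 0 < q2) (hq3pos : 0 < q3)
    (hq13 : q13 = ∫ u in a..b, p1 u * p3 u * w u)
    (R : Matrix (Fin n) (Fin n) ℝ) (hR : R.PosDef)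
    (φ : ℝ → Fin n → ℝ) (hφ : ContinuousOn φ (Set.Icc a b))
    (F0 F1 F2 F3 : Fin n → ℝ)
    (hF0 : F0 = ∫ u in a..b, w u • φ u)
    (hF1 : F1 = ∫ u in a..b, (p1 u * w u) • φ u)
    (hF2 : F2 = ∫ u in a..b, (p2 u * w u) • φ u)
    (hF3 : F3 = ∫ u in a..b, (p3 u * w u) • φ u) :
    (∫ u in a..b, w u * (φ u ⬝ᵥ R *ᵥ φ u)) ≥
      (1/q0) * (F0 ⬝ᵥ R *ᵥ F0) + (1/q1) * (F1 ⬝ᵥ R *ᵥ F1) +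
      (1/q2) * (F2 ⬝ᵥ R *ᵥ F2) +
      (1/q3) * ((F3 - (q13/q1) • F1) ⬝ᵥ R *ᵥ (F3 - (q13/q1) • F1)) := by
  have hw0 : ∀ u ∈ Set.Icc a b, 0 ≤ w u := fun u hu => (hwpos u hu).le
  let ν : Measure ℝ :=
    (volume.restrict (Set.Ioc a b)).withDensity fun u => ENNReal.ofReal (w u)
  have hac : ν ≪ volume.restrict (Set.Ioc a b) := withDensity_absolutelyContinuous _ _
  have hfin : IsFiniteMeasure ν :=
    isFiniteMeasure_withDensity_ofReal
      (hw.integrableOn_Icc.mono_set Set.Ioc_subset_Icc_self).hasFiniteIntegral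
  have hmem {E : Type} [NormedAddCommGroup E] {g : ℝ → E}
      (hg : AEStronglyMeasurable g (volume.restrict (Set.Ioc a b)))
      (hbdd : ∃ M : ℝ, ∀ u ∈ Set.Icc a b, ‖g u‖ ≤ M) : MemLp g 2 ν := by
    obtain ⟨M, hM⟩ := hbdd
    exact MemLp.of_bound (hg.mono_ac hac) M <| hac.ae_le <|
      ae_restrict_of_forall_mem measurableSet_Ioc fun u hu => hM u (Set.Ioc_subset_Icc_self hu)
  have hmem_cont {E : Type} [NormedAddCommGroup E] {g : ℝ → E}
      (hg : ContinuousOn g (Set.Icc a b)) : MemLp g 2 ν :=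
    hmem ((hg.aestronglyMeasurable_of_isCompact isCompact_Icc measurableSet_Icc).mono_set
      Set.Ioc_subset_Icc_self) (isCompact_Icc.exists_bound_of_continuousOn hg)
  have h1 : MemLp p1 2 ν := hmem_cont hp1
  have h2 : MemLp p2 2 ν := hmem_cont hp2
  have h3 : MemLp p3 2 ν := hmem hp3meas.aestronglyMeasurable hp3bdd
  have hφ2 : MemLp φ 2 ν := hmem_cont hφ
  have hscalar (g : ℝ → ℝ) : ∫ u, g u ∂ν = ∫ u in a..b, g u * w u := by
    simpa only [smul_eq_mul, mul_comm] using integral_withDensity_ofReal_Ioc hab.le hw hw0 g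
  have hvector (p : ℝ → ℝ) : ∫ u, p u • φ u ∂ν = ∫ u in a..b, (p u * w u) • φ u := by
    simpa only [smul_smul, mul_comm] using
      integral_withDensity_ofReal_Ioc hab.le hw hw0 fun u => p u • φ u
  have hq0pos : 0 < q0 := by
    rw [hq0]
    exact intervalIntegral.intervalIntegral_pos_of_pos_on
      (hw.intervalIntegrable_of_Icc hab.le)
      (fun u hu => hwpos u (Set.Ioo_subset_Icc_self hu)) hab
  have hquad : ∫ u, φ u ⬝ᵥ R *ᵥ φ u ∂ν = ∫ u in a..b, w u * (φ u ⬝ᵥ R *ᵥ φ u) :=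
    integral_withDensity_ofReal_Ioc hab.le hw hw0 _
  rw [ge_iff_le, ← hquad]
  exact quadForm_integral_smul_add_le hR.posSemidef h1 h2 h3 hφ2
    ((hscalar _).trans horth1) ((hscalar _).trans horth2) ((hscalar _).trans horth3)
    ((hscalar _).trans horth12) ((hscalar _).trans horth23) ((hscalar _).trans hq13.symm)
    (by simp_rw [hscalar, hq0, one_mul]) (by simp_rw [hscalar, hq1, sq])
    (by simp_rw [hscalar, hq2, sq]) (by simp_rw [hscalar, hq3, sq])
    hq0pos hq1pos hq2pos hq3pos
    ((integral_withDensity_ofReal_Ioc hab.le hw hw0 φ).trans hF0.symm)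
    ((hvector p1).trans hF1.symm) ((hvector p2).trans hF2.symm) ((hvector p3).trans hF3.symm)
end

section
/- Let n be a positive integer, R an n×n real symmetric matrix, and φ:[a,b]→ℝⁿ a continuous function. Define F₀=∫_a^b φ(u)w(u)du, F_i=∫_a^b p_i(u)φ(u)w(u)du for i=1,2,3, q₀=∫_a^b w(u)du, q_i=∫_a^b p_i(u)²w(u)du for i=1,2,3, and q₁₃=∫_a^b p₁(u)p₃(u)w(u)du. Set v = F₃/q₃ − (q₁₃/(q₁q₃))F₁ and e(u) = φ(u) − F₀/q₀ − (F₁/q₁)p₁(u) − (F₂/q₂)p₂(u) − p₃(u)v. Then ∫_a^b e(u)ᵀRe(u)w(u)du = ∫_a^b φ(u)ᵀRφ(u)w(u)du − (1/q₀)F₀ᵀRF₀ − (1/q₁)F₁ᵀRF₁ − (1/q₂)F₂ᵀRF₂ − q₃ vᵀRv. -/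
open Matrix intervalIntegral

/-- A bounded measurable function is interval integrable. -/
theorem intervalIntegrable_of_measurable_of_abs_le {a b M : ℝ} (hab : a ≤ b) {f : ℝ → ℝ}
    (hf : Measurable f) (hM : ∀ u ∈ Set.Icc a b, |f u| ≤ M) :
    IntervalIntegrable f MeasureTheory.volume a b := by
  rw [intervalIntegrable_iff_integrableOn_Icc_of_le hab]
  refine MeasureTheory.Measure.integrableOn_of_bounded (M := M) (by simp)
    hf.aestronglyMeasurable ?_
  filter_upwards [MeasureTheory.ae_restrict_mem measurableSet_Icc] with u hu using hM u hu

/-- The dot product with a fixed vector commutes with the interval integral. -/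
theorem integral_dotProduct_const {m : Type*} [Fintype m] {a b : ℝ} {f : ℝ → m → ℝ}
    (hf : IntervalIntegrable f MeasureTheory.volume a b) (c : m → ℝ) :
    IntervalIntegrable (fun u => f u ⬝ᵥ c) MeasureTheory.volume a b ∧
      ∫ u in a..b, f u ⬝ᵥ c = (∫ u in a..b, f u) ⬝ᵥ c := by
  let L : (m → ℝ) →L[ℝ] ℝ := LinearMap.toContinuousLinearMap (dotProductBilin ℝ ℝ |>.flip c)
  have hL : ∀ x, L x = x ⬝ᵥ c := fun x => rfl
  have h := L.intervalIntegral_comp_comm hf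
  have hi : IntervalIntegrable (fun u => L (f u)) MeasureTheory.volume a b :=
    ⟨L.integrable_comp hf.1, L.integrable_comp hf.2⟩
  simp only [hL] at h hi
  exact ⟨hi, h⟩

/-- Expansion of a symmetric quadratic form at `x - ∑ i, c i • y i`. -/
theorem dotProduct_mulVec_sub_sum {m ι : Type*} [Fintype m] [Fintype ι] {R : Matrix m m ℝ}
    (hR : R.IsSymm) (x : m → ℝ) (c : ι → ℝ) (y : ι → m → ℝ) :
    (x - ∑ i, c i • y i) ⬝ᵥ R *ᵥ (x - ∑ i, c i • y i) =
      x ⬝ᵥ R *ᵥ x - 2 * ∑ i, c i * (x ⬝ᵥ R *ᵥ y i)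
        + ∑ i, ∑ j, c i * c j * (y i ⬝ᵥ R *ᵥ y j) := by
  have hcomm : ∀ z, z ⬝ᵥ R *ᵥ x = x ⬝ᵥ R *ᵥ z := fun z => by
    rw [dotProduct_mulVec, ← mulVec_transpose, hR.eq, dotProduct_comm]
  simp only [mulVec_sub, sub_dotProduct, dotProduct_sub, hcomm]
  simp only [mulVec_sum, mulVec_smul, dotProduct_sum, sum_dotProduct, dotProduct_smul,
    smul_dotProduct, smul_eq_mul]
  have hswap : ∑ i, c i * ∑ j, c j * (y j ⬝ᵥ R *ᵥ y i) =
      ∑ i, ∑ j, c i * c j * (y i ⬝ᵥ R *ᵥ y j) := by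
    simp only [Finset.mul_sum]
    rw [Finset.sum_comm]
    exact Finset.sum_congr rfl fun i _ => Finset.sum_congr rfl fun j _ => by ring
  rw [hswap]
  ring

/-- Expansion of the weighted integral of a symmetric quadratic form evaluated at the difference
of `φ` and a linear combination of fixed vectors with variable coefficients. -/
theorem integral_quadratic_sub_sum {m ι : Type*} [Fintype m] [Fintype ι] {a b : ℝ} {w : ℝ → ℝ}
    {p : ι → ℝ → ℝ} {φ : ℝ → m → ℝ} {R : Matrix m m ℝ} (hR : R.IsSymm)
    (hφφ : IntervalIntegrable (fun u => w u * (φ u ⬝ᵥ R *ᵥ φ u)) MeasureTheory.volume a b)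
    (hpφ : ∀ i, IntervalIntegrable (fun u => (p i u * w u) • φ u) MeasureTheory.volume a b)
    (hpp : ∀ i j, IntervalIntegrable (fun u => p i u * p j u * w u) MeasureTheory.volume a b)
    (c : ι → m → ℝ) :
    ∫ u in a..b, w u * ((φ u - ∑ i, p i u • c i) ⬝ᵥ R *ᵥ (φ u - ∑ i, p i u • c i)) =
      (∫ u in a..b, w u * (φ u ⬝ᵥ R *ᵥ φ u))
        - 2 * ∑ i, (∫ u in a..b, (p i u * w u) • φ u) ⬝ᵥ R *ᵥ c i
        + ∑ i, ∑ j, (∫ u in a..b, p i u * p j u * w u) * (c i ⬝ᵥ R *ᵥ c j) := by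
  have hlin := fun i => integral_dotProduct_const (hpφ i) (R *ᵥ c i)
  have hquad := fun i j => (hpp i j).mul_const (c i ⬝ᵥ R *ᵥ c j)
  have hlin_sum : IntervalIntegrable
      (fun u => 2 * ∑ i, ((p i u * w u) • φ u) ⬝ᵥ R *ᵥ c i) MeasureTheory.volume a b := by
    have := IntervalIntegrable.sum Finset.univ fun i _ => (hlin i).1
    simpa only [Finset.sum_fn] using this.const_mul 2
  have hquad_row : ∀ i, IntervalIntegrable
      (fun u => ∑ j, p i u * p j u * w u * (c i ⬝ᵥ R *ᵥ c j)) MeasureTheory.volume a b := by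
    intro i
    simpa only [Finset.sum_fn] using IntervalIntegrable.sum Finset.univ fun j _ => hquad i j
  have hquad_sum : IntervalIntegrable
      (fun u => ∑ i, ∑ j, p i u * p j u * w u * (c i ⬝ᵥ R *ᵥ c j))
      MeasureTheory.volume a b := by
    simpa only [Finset.sum_fn] using IntervalIntegrable.sum Finset.univ fun i _ => hquad_row i
  have hexpand : ∀ u,
      w u * ((φ u - ∑ i, p i u • c i) ⬝ᵥ R *ᵥ (φ u - ∑ i, p i u • c i)) =
        w u * (φ u ⬝ᵥ R *ᵥ φ u) - 2 * ∑ i, ((p i u * w u) • φ u) ⬝ᵥ R *ᵥ c i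
          + ∑ i, ∑ j, p i u * p j u * w u * (c i ⬝ᵥ R *ᵥ c j) := by
    intro u
    rw [dotProduct_mulVec_sub_sum hR, mul_add, mul_sub, mul_left_comm]
    simp only [Finset.mul_sum, smul_dotProduct, smul_eq_mul, mul_assoc, mul_left_comm (w u)]
  simp only [hexpand]
  rw [integral_add (hφφ.sub hlin_sum) hquad_sum, integral_sub hφφ hlin_sum, integral_const_mul,
    integral_finsetSum fun i _ => (hlin i).1, integral_finsetSum fun i _ => hquad_row i]
  simp only [(hlin _).2, integral_finsetSum fun j _ => hquad _ j, integral_mul_const]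

theorem weighted_error_identity
    {n : ℕ} (hn : 0 < n)
    (a b : ℝ) (hab : a < b)
    (w p1 p2 p3 : ℝ → ℝ)
    (hw : ContinuousOn w (Set.Icc a b))
    (hwpos : ∀ u ∈ Set.Icc a b, 0 < w u)
    (hp1 : ContinuousOn p1 (Set.Icc a b))
    (hp2 : ContinuousOn p2 (Set.Icc a b))
    (hp3meas : Measurable p3)
    (hp3bdd : ∃ M : ℝ, ∀ u ∈ Set.Icc a b, |p3 u| ≤ M)
    (horth1 : (∫ u in a..b, p1 u * w u) = 0)
    (horth2 : (∫ u in a..b, p2 u * w u) = 0)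
    (horth3 : (∫ u in a..b, p3 u * w u) = 0)
    (horth12 : (∫ u in a..b, p1 u * p2 u * w u) = 0)
    (horth23 : (∫ u in a..b, p2 u * p3 u * w u) = 0)
    (q0 q1 q2 q3 q13 : ℝ)
    (hq0 : q0 = ∫ u in a..b, w u)
    (hq1 : q1 = ∫ u in a..b, (p1 u)^2 * w u)
    (hq2 : q2 = ∫ u in a..b, (p2 u)^2 * w u)
    (hq3 : q3 = ∫ u in a..b, (p3 u)^2 * w u)
    (hq1pos : 0 < q1) (hq2pos : 0 < q2) (hq3pos : 0 < q3)
    (hq13 : q13 = ∫ u in a..b, p1 u * p3 u * w u)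
    (R : Matrix (Fin n) (Fin n) ℝ) (hR : R.IsSymm)
    (φ : ℝ → Fin n → ℝ) (hφ : ContinuousOn φ (Set.Icc a b))
    (F0 F1 F2 F3 : Fin n → ℝ)
    (hF0 : F0 = ∫ u in a..b, w u • φ u)
    (hF1 : F1 = ∫ u in a..b, (p1 u * w u) • φ u)
    (hF2 : F2 = ∫ u in a..b, (p2 u * w u) • φ u)
    (hF3 : F3 = ∫ u in a..b, (p3 u * w u) • φ u)
    (v : Fin n → ℝ)
    (hv : v = (1/q3) • F3 - (q13/(q1*q3)) • F1)
    (e : ℝ → Fin n → ℝ)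
    (he : ∀ u, e u = φ u - (1/q0) • F0 - (p1 u / q1) • F1 - (p2 u / q2) • F2
        - p3 u • v) :
    (∫ u in a..b, w u * (e u ⬝ᵥ R *ᵥ e u)) =
      (∫ u in a..b, w u * (φ u ⬝ᵥ R *ᵥ φ u))
        - (1/q0) * (F0 ⬝ᵥ R *ᵥ F0) - (1/q1) * (F1 ⬝ᵥ R *ᵥ F1)
        - (1/q2) * (F2 ⬝ᵥ R *ᵥ F2) - q3 * (v ⬝ᵥ R *ᵥ v) := by
  obtain ⟨M, hM⟩ := hp3bdd
  have huIcc : Set.uIcc a b = Set.Icc a b := Set.uIcc_of_le hab.le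
  have hp3int := intervalIntegrable_of_measurable_of_abs_le hab.le hp3meas hM
  have hp3sq : IntervalIntegrable (fun u => p3 u * p3 u) MeasureTheory.volume a b :=
    intervalIntegrable_of_measurable_of_abs_le (M := M * M) hab.le (hp3meas.mul hp3meas)
      fun u hu => by
        rw [abs_mul]
        exact mul_self_le_mul_self (abs_nonneg _) (hM u hu)
  have hq0pos : 0 < q0 := by
    rw [hq0]
    exact intervalIntegral_pos_of_pos_on (hw.intervalIntegrable_of_Icc hab.le)
      (fun u hu => hwpos u (Set.Ioo_subset_Icc_self hu)) hab
  rw [← huIcc] at hw hp1 hp2 hφ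
  have hφφ : IntervalIntegrable (fun u => w u * (φ u ⬝ᵥ R *ᵥ φ u))
      MeasureTheory.volume a b := by
    refine (hw.mul ?_).intervalIntegrable
    have hquad : Continuous fun x : Fin n → ℝ => x ⬝ᵥ R *ᵥ x := by fun_prop
    exact hquad.comp_continuousOn hφ
  let p : Fin 4 → ℝ → ℝ := ![fun _ => 1, p1, p2, p3]
  let c : Fin 4 → Fin n → ℝ := ![(1/q0) • F0, (1/q1) • F1, (1/q2) • F2, v]
  have hp_cont : ∀ i : Fin 3, ContinuousOn (p i.castSucc) (Set.uIcc a b) := by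
    intro i
    fin_cases i
    exacts [continuousOn_const, hp1, hp2]
  have hpint : ∀ i, IntervalIntegrable (p i) MeasureTheory.volume a b := by
    intro i
    induction i using Fin.lastCases with
    | last => exact hp3int
    | cast i => exact (hp_cont i).intervalIntegrable
  have hppint : ∀ i j, IntervalIntegrable (fun u => p i u * p j u)
      MeasureTheory.volume a b := by
    intro i j
    induction i using Fin.lastCases with
    | cast i => exact (hpint j).continuousOn_mul (hp_cont i)
    | last =>
      induction j using Fin.lastCases with
      | cast j => exact hp3int.mul_continuousOn (hp_cont j)
      | last => exact hp3sq
  have key := integral_quadratic_sub_sum (p := p) hR hφφ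
    (fun i => ((hpint i).mul_continuousOn hw).smul_continuousOn hφ)
    (fun i j => (hppint i j).mul_continuousOn hw) c
  have he' : ∀ u, e u = φ u - ∑ i, p i u • c i := by
    intro u
    rw [he, Fin.sum_univ_four]
    simp only [p, c, Matrix.cons_val, smul_smul, mul_one_div]
    abel
  simp only [he', key]
  have horth21 : ∫ u in a..b, p2 u * p1 u * w u = 0 := by simpa only [mul_comm (p2 _)] using horth12
  have horth32 : ∫ u in a..b, p3 u * p2 u * w u = 0 := by simpa only [mul_comm (p3 _)] using horth23
  have hq31 : ∫ u in a..b, p3 u * p1 u * w u = q13 := by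
    simpa only [mul_comm (p3 _)] using hq13.symm
  have hcomm : F1 ⬝ᵥ R *ᵥ v = v ⬝ᵥ R *ᵥ F1 := by
    rw [dotProduct_mulVec, ← mulVec_transpose, hR.eq, dotProduct_comm]
  have hF3v : F3 = q3 • v + (q13 / q1) • F1 := by
    ext k
    simp only [hv, Pi.add_apply, Pi.sub_apply, Pi.smul_apply, smul_eq_mul]
    field_simp
    ring
  simp only [pow_two] at hq1 hq2 hq3
  simp only [Fin.sum_univ_four, p, c, Matrix.cons_val, one_mul, mul_one, ← hF0, ← hF1, ← hF2,
    ← hF3, ← hq0, ← hq1, ← hq2, ← hq3, ← hq13, hq31, horth1, horth2, horth3, horth12, horth21,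
    horth23, horth32]
  rw [hF3v]
  simp only [mulVec_smul, dotProduct_smul, smul_dotProduct, add_dotProduct, smul_eq_mul, hcomm]
  field_simp
  ring
end

section
/- Let n be a positive integer, R an n×n real symmetric positive definite matrix, and z:[a,b]→ℝⁿ a continuous function. Define Ω₀ = ∫_a^b z(u)du, Ω₁ = c₁∫_a^b z(u)du + ∫_a^b∫_s^b z(u)du ds, Ω₂ = c₃∫_a^b z(u)du + c₂∫_a^b∫_s^b z(u)du ds + 2∫_a^b∫_s^b∫_u^b z(v)dv du ds, and Ω₃ = ∫_a^b z(u)du + c₄∫_a^ξ z(u)du. Then ∫_a^b e^{2k(u−b)} z(u)ᵀRz(u)du ≥ (1/q₀)Ω₀ᵀRΩ₀ + (1/q₁)Ω₁ᵀRΩ₁ + (1/q₂)Ω₂ᵀRΩ₂ + (1/q₃)(Ω₃ − (q₁₃/q₁)Ω₁)ᵀR(Ω₃ − (q₁₃/q₁)Ω₁). -/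
open Matrix intervalIntegral MeasureTheory

/-- The Bessel inequality for a vector-valued function and finitely many scalar functions that are
pairwise orthogonal for the weight `w`, measured by a positive semidefinite bilinear form. -/
theorem sum_inv_mul_integral_smul_le {E ι : Type*} [NormedAddCommGroup E] [NormedSpace ℝ E]
    [CompleteSpace E] [Fintype ι]
    (B : E →L[ℝ] E →L[ℝ] ℝ) (hsymm : ∀ x y, B x y = B y x) (hnonneg : ∀ x, 0 ≤ B x x)
    {a b : ℝ} (hab : a ≤ b) {w : ℝ → ℝ} (hw : ∀ u, 0 < w u) {f : ι → ℝ → ℝ} {z : ℝ → E}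
    {q : ι → ℝ} (hq : ∀ i, 0 < q i)
    (hff : ∀ i j, IntervalIntegrable (fun u => f i u * f j u * w u) volume a b)
    (hfz : ∀ i, IntervalIntegrable (fun u => f i u • z u) volume a b)
    (hzz : IntervalIntegrable (fun u => (w u)⁻¹ * B (z u) (z u)) volume a b)
    (horth : ∀ i j, i ≠ j → ∫ u in a..b, f i u * f j u * w u = 0)
    (hnorm : ∀ i, ∫ u in a..b, f i u * f i u * w u ≤ q i) :
    ∑ i, (q i)⁻¹ * B (∫ u in a..b, f i u • z u) (∫ u in a..b, f i u • z u) ≤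
      ∫ u in a..b, (w u)⁻¹ * B (z u) (z u) := by
  classical
  set Ω : ι → E := fun i => ∫ u in a..b, f i u • z u
  have hlin : ∀ i, IntervalIntegrable (fun u => (q i)⁻¹ * B (Ω i) (f i u • z u)) volume a b :=
    fun i => IntervalIntegrable.const_mul
      ⟨(B (Ω i)).integrable_comp (hfz i).1, (B (Ω i)).integrable_comp (hfz i).2⟩ _
  have hquad : ∀ i j, IntervalIntegrable
      (fun u => (q i)⁻¹ * (q j)⁻¹ * B (Ω i) (Ω j) * (f i u * f j u * w u)) volume a b :=
    fun i j => (hff i j).const_mul _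
  have hpointwise : ∀ u, 0 ≤ (w u)⁻¹ * B (z u) (z u)
      - 2 * ∑ i, (q i)⁻¹ * B (Ω i) (f i u • z u)
      + ∑ i, ∑ j, (q i)⁻¹ * (q j)⁻¹ * B (Ω i) (Ω j) * (f i u * f j u * w u) := by
    intro u
    have h := mul_nonneg (inv_nonneg.2 (hw u).le)
      (hnonneg (z u - w u • ∑ i, ((q i)⁻¹ * f i u) • Ω i))
    refine h.trans_eq ?_
    have hw0 := (hw u).ne'
    have h1 : ∑ i, (q i)⁻¹ * B (Ω i) (f i u • z u) =
        B (∑ i, ((q i)⁻¹ * f i u) • Ω i) (z u) := by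
      simp [map_sum, mul_assoc]
    have h2 : ∑ i, ∑ j, (q i)⁻¹ * (q j)⁻¹ * B (Ω i) (Ω j) * (f i u * f j u * w u) =
        w u * B (∑ i, ((q i)⁻¹ * f i u) • Ω i) (∑ i, ((q i)⁻¹ * f i u) • Ω i) := by
      simp only [map_sum, _root_.sum_apply, map_smul, _root_.smul_apply,
        Finset.mul_sum, smul_eq_mul]
      rw [Finset.sum_comm]
      refine Finset.sum_congr rfl fun i _ => Finset.sum_congr rfl fun j _ => by ring
    rw [h1, h2]
    simp only [map_sub, map_smul, _root_.sub_apply, _root_.smul_apply,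
      smul_eq_mul]
    rw [hsymm (z u) (∑ i, _)]
    field_simp
    ring
  have hint := intervalIntegral.integral_nonneg_of_forall (μ := volume) hab hpointwise
  have hlinsum : IntervalIntegrable (fun u => ∑ i, (q i)⁻¹ * B (Ω i) (f i u • z u)) volume a b := by
    simpa only [Finset.sum_fn] using IntervalIntegrable.sum Finset.univ fun i _ => hlin i
  have hquadrow : ∀ i, IntervalIntegrable
      (fun u => ∑ j, (q i)⁻¹ * (q j)⁻¹ * B (Ω i) (Ω j) * (f i u * f j u * w u)) volume a b := by
    intro i
    simpa only [Finset.sum_fn] using IntervalIntegrable.sum Finset.univ fun j _ => hquad i j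
  have hquadsum : IntervalIntegrable
      (fun u => ∑ i, ∑ j, (q i)⁻¹ * (q j)⁻¹ * B (Ω i) (Ω j) * (f i u * f j u * w u))
      volume a b := by
    simpa only [Finset.sum_fn] using IntervalIntegrable.sum Finset.univ fun i _ => hquadrow i
  rw [integral_add (hzz.sub (hlinsum.const_mul 2)) hquadsum,
    integral_sub hzz (hlinsum.const_mul 2), intervalIntegral.integral_const_mul,
    integral_finsetSum fun i _ => hlin i, integral_finsetSum fun i _ => hquadrow i] at hint
  have hlinval : ∀ i, ∫ u in a..b, (q i)⁻¹ * B (Ω i) (f i u • z u) =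
      (q i)⁻¹ * B (Ω i) (Ω i) := fun i => by
    rw [intervalIntegral.integral_const_mul, (B (Ω i)).intervalIntegral_comp_comm (hfz i)]
  have hquadval : ∀ i, ∫ u in a..b,
      ∑ j, (q i)⁻¹ * (q j)⁻¹ * B (Ω i) (Ω j) * (f i u * f j u * w u) ≤
      (q i)⁻¹ * B (Ω i) (Ω i) := fun i => by
    rw [integral_finsetSum fun j _ => hquad i j, Finset.sum_eq_single i]
    · rw [intervalIntegral.integral_const_mul]
      have hqi := hq i
      calc _ ≤ (q i)⁻¹ * (q i)⁻¹ * B (Ω i) (Ω i) * q i := by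
            have := hnonneg (Ω i)
            gcongr
            exact hnorm i
        _ = _ := by field_simp
    · intro j _ hji
      rw [intervalIntegral.integral_const_mul, horth i j hji.symm, mul_zero]
    · simp
  have hsum := Finset.sum_le_sum fun i (_ : i ∈ Finset.univ) => hquadval i
  simp only [hlinval] at hint
  linarith

theorem ContinuousOn.tail_integral {E : Type*} [NormedAddCommGroup E] [NormedSpace ℝ E]
    {a b : ℝ} (hab : a ≤ b) {z : ℝ → E} (hz : ContinuousOn z (Set.Icc a b)) :
    ContinuousOn (fun u => ∫ v in u..b, z v) (Set.Icc a b) := by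
  rw [← Set.uIcc_of_le hab] at hz ⊢
  exact continuousOn_primitive_interval_left (hz.integrableOn_compact isCompact_uIcc)

/-- Integration by parts of `(u - a) ^ m` against the tail integral of `z`. -/
theorem integral_pow_smul_tail_integral {E : Type*} [NormedAddCommGroup E] [NormedSpace ℝ E]
    [CompleteSpace E] {a b : ℝ} (hab : a ≤ b) {z : ℝ → E} (hz : ContinuousOn z (Set.Icc a b))
    (m : ℕ) :
    ∫ u in a..b, ((m + 1 : ℝ) * (u - a) ^ m) • ∫ v in u..b, z v =
      ∫ u in a..b, (u - a) ^ (m + 1) • z u := by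
  have htail := hz.tail_integral hab
  have hl : ContinuousOn (fun u => ((m + 1 : ℝ) * (u - a) ^ m) • ∫ v in u..b, z v)
      (Set.Icc a b) := by fun_prop
  have hr : ContinuousOn (fun u => (u - a) ^ (m + 1) • z u) (Set.Icc a b) := by fun_prop
  have hli := hl.intervalIntegrable_of_Icc (μ := volume) hab
  have hri := hr.intervalIntegrable_of_Icc (μ := volume) hab
  have hFTC := intervalIntegral.integral_eq_sub_of_hasDerivAt_of_le hab
    (f := fun u => (u - a) ^ (m + 1) • ∫ v in u..b, z v)
    (f' := fun u => ((m + 1 : ℝ) * (u - a) ^ m) • (∫ v in u..b, z v) - (u - a) ^ (m + 1) • z u)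
    (by fun_prop) (fun x hx => by
      have h1 : HasDerivAt (fun u => ∫ v in u..b, z v) (-z x) x :=
        intervalIntegral.integral_hasDerivAt_left
          ((hz.mono (Set.Icc_subset_Icc_left hx.1.le)).intervalIntegrable_of_Icc hx.2.le)
          ((hz.mono Set.Ioo_subset_Icc_self).stronglyMeasurableAtFilter isOpen_Ioo x hx)
          (hz.continuousAt (Icc_mem_nhds hx.1 hx.2))
      have h2 : HasDerivAt (fun u : ℝ => (u - a) ^ (m + 1)) ((m + 1 : ℝ) * (x - a) ^ m) x := by
        simpa using ((hasDerivAt_id' x).sub_const a).fun_pow (m + 1)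
      refine (h2.fun_smul h1).congr_deriv ?_
      rw [smul_neg, add_comm, ← sub_eq_add_neg])
    (hli.sub hri)
  rw [intervalIntegral.integral_sub hli hri] at hFTC
  simpa [sub_eq_zero] using hFTC

/-- Integration against the step function `1 + c * 1_[a, ξ]`. -/
theorem intervalIntegrable_and_integral_step_smul {E : Type*} [NormedAddCommGroup E]
    [NormedSpace ℝ E]
    {a b ξ : ℝ} (hξ : ξ ∈ Set.Icc a b) (c : ℝ) {h : ℝ → E} (hh : IntervalIntegrable h volume a b) :
    IntervalIntegrable
        (fun u => (1 + c * (Set.Icc a ξ).indicator (fun _ => (1 : ℝ)) u) • h u) volume a b ∧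
      ∫ u in a..b, (1 + c * (Set.Icc a ξ).indicator (fun _ => (1 : ℝ)) u) • h u =
        (∫ u in a..b, h u) + c • ∫ u in a..ξ, h u := by
  have heq : (fun u => (1 + c * (Set.Icc a ξ).indicator (fun _ => (1 : ℝ)) u) • h u) =
      fun u => h u + c • (Set.Icc a ξ).indicator h u := by
    ext u
    by_cases hu : u ∈ Set.Icc a ξ <;> simp [hu, add_smul]
  have hab := hξ.1.trans hξ.2
  have hind : IntervalIntegrable ((Set.Icc a ξ).indicator h) volume a b := by
    rw [intervalIntegrable_iff] at hh ⊢
    exact hh.indicator measurableSet_Icc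
  have hval : ∫ u in a..b, (Set.Icc a ξ).indicator h u = ∫ u in a..ξ, h u := by
    rw [← intervalIntegral.integral_indicator hξ]
    refine intervalIntegral.integral_congr_ae (.of_forall fun u hu => ?_)
    rw [Set.uIoc_of_le hab] at hu
    by_cases h : u ≤ ξ <;> simp [Set.indicator, h, hu.1.le]
  rw [heq]
  refine ⟨hh.add (hind.smul c), ?_⟩
  rw [← hval, ← intervalIntegral.integral_smul]
  exact intervalIntegral.integral_add hh (hind.smul c)

theorem exp_weighted_integral_inequality
    {n : ℕ} (hn : 0 < n)
    (k a b : ℝ) (hk : 0 < k) (hab : a < b)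
    (W : ℝ) (hW : W = Real.exp (2*k*(b-a)))
    (w : ℝ → ℝ) (hw : ∀ u, w u = Real.exp (-(2*k*(u-b))))
    (c1 : ℝ) (hc1 : c1 = (b-a)/(W-1) - 1/(2*k))
    (p1 : ℝ → ℝ) (hp1 : ∀ u, p1 u = (u-a) + c1)
    (c2 c3 : ℝ) (p2 : ℝ → ℝ)
    (hp2 : ∀ u, p2 u = (u-a)^2 + c2*(u-a) + c3)
    (hp2orth : (∫ u in a..b, p2 u * w u) = 0)
    (hp12orth : (∫ u in a..b, p1 u * p2 u * w u) = 0)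
    (ξ : ℝ) (hξ : ξ ∈ Set.Ioo a b)
    (hξzero : (∫ u in a..ξ, p2 u * w u) = 0)
    (c4 : ℝ) (hc4 : c4 = -(∫ u in a..b, w u) / (∫ u in a..ξ, w u))
    (p3 : ℝ → ℝ)
    (hp3 : ∀ u, p3 u = 1 + c4 * Set.indicator (Set.Icc a ξ) (fun _ => (1:ℝ)) u)
    (q0 q1 q2 q3 q13 : ℝ)
    (hq0 : q0 = ∫ u in a..b, w u)
    (hq1 : q1 = ∫ u in a..b, (p1 u)^2 * w u)
    (hq2 : q2 = ∫ u in a..b, (p2 u)^2 * w u)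
    (hq3 : q3 = ∫ u in a..b, (p3 u)^2 * w u)
    (hq0pos : 0 < q0) (hq1pos : 0 < q1) (hq2pos : 0 < q2) (hq3pos : 0 < q3)
    (hq13 : q13 = ∫ u in a..b, p1 u * p3 u * w u)
    (R : Matrix (Fin n) (Fin n) ℝ) (hR : R.PosDef)
    (z : ℝ → Fin n → ℝ) (hz : ContinuousOn z (Set.Icc a b))
    (Ω0 Ω1 Ω2 Ω3 : Fin n → ℝ)
    (hΩ0 : Ω0 = ∫ u in a..b, z u)
    (hΩ1 : Ω1 = c1 • (∫ u in a..b, z u) + ∫ s in a..b, ∫ u in s..b, z u)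
    (hΩ2 : Ω2 = c3 • (∫ u in a..b, z u) + c2 • (∫ s in a..b, ∫ u in s..b, z u)
        + (2:ℝ) • (∫ s in a..b, ∫ u in s..b, ∫ v in u..b, z v))
    (hΩ3 : Ω3 = (∫ u in a..b, z u) + c4 • (∫ u in a..ξ, z u)) :
    (∫ u in a..b, Real.exp (2*k*(u-b)) * (z u ⬝ᵥ R *ᵥ z u)) ≥
      (1/q0) * (Ω0 ⬝ᵥ R *ᵥ Ω0) + (1/q1) * (Ω1 ⬝ᵥ R *ᵥ Ω1) +
      (1/q2) * (Ω2 ⬝ᵥ R *ᵥ Ω2) +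
      (1/q3) * ((Ω3 - (q13/q1) • Ω1) ⬝ᵥ R *ᵥ (Ω3 - (q13/q1) • Ω1)) := by
  have hwc : Continuous w := by rw [funext hw]; fun_prop
  have hwpos : ∀ u, 0 < w u := fun u => by rw [hw]; exact Real.exp_pos _
  have hp1c : Continuous p1 := by rw [funext hp1]; fun_prop
  have hp2c : Continuous p2 := by rw [funext hp2]; fun_prop
  have hzi : IntervalIntegrable z volume a b := hz.intervalIntegrable_of_Icc hab.le
  have hξ' : ξ ∈ Set.Icc a b := ⟨hξ.1.le, hξ.2.le⟩
  have hwi : IntervalIntegrable w volume a b := hwc.intervalIntegrable _ _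
  have hsmul : ∀ (E : Type) [NormedAddCommGroup E] [NormedSpace ℝ E] (p : ℝ → ℝ) (h : ℝ → E),
      Continuous p → IntervalIntegrable h volume a b →
      IntervalIntegrable (fun u => p u • h u) volume a b :=
    fun E _ _ p h hp hh => hh.continuousOn_smul hp.continuousOn
  have hp3smul : ∀ (E : Type) [NormedAddCommGroup E] [NormedSpace ℝ E] (h : ℝ → E),
      IntervalIntegrable h volume a b →
      IntervalIntegrable (fun u => p3 u • h u) volume a b ∧
        ∫ u in a..b, p3 u • h u = (∫ u in a..b, h u) + c4 • ∫ u in a..ξ, h u := by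
    intro E _ _ h hh
    simpa only [hp3] using intervalIntegrable_and_integral_step_smul hξ' c4 hh
  set r := q13 / q1 with hr
  set g : ℝ → ℝ := fun u => p3 u - r * p1 u with hg
  have hgsmul : ∀ (E : Type) [NormedAddCommGroup E] [NormedSpace ℝ E] (h : ℝ → E),
      IntervalIntegrable h volume a b →
      IntervalIntegrable (fun u => g u • h u) volume a b ∧
        ∫ u in a..b, g u • h u = (∫ u in a..b, p3 u • h u) - r • ∫ u in a..b, p1 u • h u := by
    intro E _ _ h hh
    have h3 := (hp3smul E h hh).1
    have h1 := (hsmul E p1 h hp1c hh).smul r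
    have heq : (fun u => g u • h u) = fun u => p3 u • h u - r • p1 u • h u := by
      ext u
      simp only [hg, sub_smul, mul_smul]
    rw [heq, ← intervalIntegral.integral_smul]
    exact ⟨h3.sub h1, intervalIntegral.integral_sub h3 h1⟩
  have hO01 : ∫ u in a..b, p1 u * w u = 0 := by
    have hW1 : W - 1 ≠ 0 := by
      have : 1 < W := by
        rw [hW]
        exact Real.one_lt_exp_iff.2 (by have := sub_pos.2 hab; positivity)
      linarith
    have hderiv : ∀ x ∈ Set.uIcc a b, HasDerivAt
        (fun u => -((u - a) + c1 + 1 / (2 * k)) / (2 * k) * Real.exp (-(2 * k * (u - b))))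
        (p1 x * w x) x := by
      intro x _
      have h1 : HasDerivAt (fun u => -((u - a) + c1 + 1 / (2 * k)) / (2 * k)) (-1 / (2 * k)) x :=
        (((((hasDerivAt_id' x).sub_const a).add_const c1).add_const _).fun_neg).div_const _
      have h2 : HasDerivAt (fun u => Real.exp (-(2 * k * (u - b))))
          (Real.exp (-(2 * k * (x - b))) * -(2 * k * 1)) x :=
        ((((hasDerivAt_id' x).sub_const b).const_mul (2 * k)).fun_neg).exp
      refine (h1.fun_mul h2).congr_deriv ?_
      rw [hp1, hw]
      field_simp
      ring
    rw [intervalIntegral.integral_eq_sub_of_hasDerivAt hderiv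
      ((hp1c.mul hwc).intervalIntegrable _ _)]
    have hexp : Real.exp (-(2 * k * (a - b))) = W := by rw [hW]; congr 1; ring
    rw [hexp, hc1]
    simp only [sub_self, mul_zero, neg_zero, Real.exp_zero]
    field_simp
    ring
  have hp1w := hsmul ℝ p1 w hp1c hwi
  have hp2w := hsmul ℝ p2 w hp2c hwi
  have hp3w := hp3smul ℝ w hwi
  have hgw := hgsmul ℝ w hwi
  have hξw : ∫ u in a..ξ, w u ≠ 0 :=
    (intervalIntegral.intervalIntegral_pos_of_pos (hwc.intervalIntegrable _ _) hwpos hξ.1).ne'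
  have hO03 : ∫ u in a..b, g u * w u = 0 := by
    have h := hgw.2
    rw [hp3w.2] at h
    simp only [smul_eq_mul] at h
    rw [h, hO01, hc4]
    field_simp
    ring
  have hO13 : ∫ u in a..b, g u * (p1 u * w u) = 0 := by
    have h := (hgsmul ℝ _ hp1w).2
    have e1 : ∫ u in a..b, p3 u * (p1 u * w u) = q13 := by
      rw [hq13]; congr 1; ext u; ring
    have e2 : ∫ u in a..b, p1 u * (p1 u * w u) = q1 := by
      rw [hq1]; congr 1; ext u; ring
    simp only [smul_eq_mul] at h
    rw [h, e1, e2, hr]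
    field_simp
    ring
  have hO23 : ∫ u in a..b, g u * (p2 u * w u) = 0 := by
    have h := (hgsmul ℝ _ hp2w).2
    rw [(hp3smul ℝ _ hp2w).2] at h
    have e2 : ∫ u in a..b, p1 u * (p2 u * w u) = 0 := by
      rw [← hp12orth]; congr 1; ext u; ring
    simp only [smul_eq_mul] at h
    rw [h, e2, hp2orth, hξzero]
    ring
  have hO33 : ∫ u in a..b, g u * (g u * w u) ≤ q3 := by
    have h := (hgsmul ℝ _ hgw.1).2
    have hp3g := (hgsmul ℝ _ hp3w.1).2
    simp only [smul_eq_mul] at h hp3g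
    have e1 : ∫ u in a..b, p1 u * (g u * w u) = 0 := by
      rw [← hO13]; congr 1; ext u; ring
    have e2 : ∫ u in a..b, p3 u * (g u * w u) = ∫ u in a..b, g u * (p3 u * w u) := by
      congr 1; ext u; ring
    have e3 : ∫ u in a..b, p3 u * (p3 u * w u) = q3 := by
      rw [hq3]; congr 1; ext u; ring
    have e4 : ∫ u in a..b, p1 u * (p3 u * w u) = q13 := by
      rw [hq13]; congr 1; ext u; ring
    have hrq : 0 ≤ r * q13 := by
      rw [hr, div_mul_eq_mul_div]
      exact div_nonneg (mul_self_nonneg _) hq1pos.le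
    rw [h, e1, e2, hp3g, e3, e4]
    linarith
  have hmom1 : ∫ s in a..b, ∫ u in s..b, z u = ∫ u in a..b, (u - a) • z u := by
    simpa using integral_pow_smul_tail_integral hab.le hz 0
  have hmom2 : (2 : ℝ) • ∫ s in a..b, ∫ u in s..b, ∫ v in u..b, z v =
      ∫ u in a..b, (u - a) ^ 2 • z u := by
    have h1 : ∫ s in a..b, ∫ u in s..b, ∫ v in u..b, z v =
        ∫ u in a..b, (u - a) • ∫ v in u..b, z v := by
      simpa using integral_pow_smul_tail_integral hab.le (hz.tail_integral hab.le) 0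
    have h2 := integral_pow_smul_tail_integral hab.le hz 1
    rw [h1, ← intervalIntegral.integral_smul, ← h2]
    congr 1
    ext1 u
    rw [smul_smul]
    norm_num
  have hz1 : IntervalIntegrable (fun u => (u - a) • z u) volume a b :=
    hsmul _ _ z (by fun_prop) hzi
  have hzc : ∀ c : ℝ, IntervalIntegrable (fun u => c • z u) volume a b := hzi.smul
  have hzc1 : IntervalIntegrable (fun u => c2 • (u - a) • z u) volume a b := hz1.smul c2
  have hz2 : IntervalIntegrable (fun u => (u - a) ^ 2 • z u) volume a b :=
    hsmul _ _ z (by fun_prop) hzi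
  have hΩ1' : ∫ u in a..b, p1 u • z u = Ω1 := by
    rw [hΩ1, hmom1, add_comm, ← intervalIntegral.integral_smul,
      ← intervalIntegral.integral_add hz1 (hzc c1)]
    simp only [hp1, add_smul]
  have hΩ2' : ∫ u in a..b, p2 u • z u = Ω2 := by
    rw [hΩ2, hmom1, hmom2, ← intervalIntegral.integral_smul, ← intervalIntegral.integral_smul,
      ← intervalIntegral.integral_add (hzc c3) hzc1,
      ← intervalIntegral.integral_add ((hzc c3).add hzc1) hz2]
    congr 1
    ext1 u
    simp only [hp2, add_smul, mul_smul]
    abel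
  have hΩ3' : ∫ u in a..b, g u • z u = Ω3 - r • Ω1 := by
    rw [(hgsmul _ z hzi).2, (hp3smul _ z hzi).2, hΩ1', hΩ3]
  let B : (Fin n → ℝ) →L[ℝ] (Fin n → ℝ) →L[ℝ] ℝ :=
    (Matrix.toLinearMap₂' ℝ R).toContinuousBilinearMap
  have hB : ∀ x y, B x y = x ⬝ᵥ R *ᵥ y := fun x y => Matrix.toLinearMap₂'_apply' R x y
  have hsymm : ∀ x y, B x y = B y x := fun x y => by
    rw [hB, hB, Matrix.dotProduct_mulVec, dotProduct_comm, ← Matrix.mulVec_transpose,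
      ← Matrix.conjTranspose_eq_transpose_of_trivial, hR.isHermitian.eq]
  have hnonneg : ∀ x, 0 ≤ B x x := fun x => by
    rw [hB]
    simpa using hR.posSemidef.dotProduct_mulVec_nonneg x
  let f : Fin 4 → ℝ → ℝ := ![fun _ => 1, p1, p2, g]
  have hfsmul : ∀ (E : Type) [NormedAddCommGroup E] [NormedSpace ℝ E] (h : ℝ → E),
      IntervalIntegrable h volume a b → ∀ i,
      IntervalIntegrable (fun u => f i u • h u) volume a b := by
    intro E _ _ h hh i
    fin_cases i
    · exact hsmul E _ h continuous_const hh
    · exact hsmul E p1 h hp1c hh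
    · exact hsmul E p2 h hp2c hh
    · exact (hgsmul E h hh).1
  have hlt : ∀ i j, i < j → ∫ u in a..b, f j u * (f i u * w u) = 0 := by
    intro i j hij
    fin_cases i <;> fin_cases j <;> first | exact absurd hij (by decide) | skip
    · simpa [f] using hO01
    · simpa [f] using hp2orth
    · simpa [f] using hO03
    · calc _ = ∫ u in a..b, p1 u * p2 u * w u := by
            congr 1; ext u; simp only [f]; simp; ring
        _ = 0 := hp12orth
    · exact hO13
    · exact hO23
  have hbessel := sum_inv_mul_integral_smul_le B hsymm hnonneg hab.le hwpos (f := f) (z := z)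
    (q := ![q0, q1, q2, q3])
    (by intro i; fin_cases i <;> assumption)
    (fun i j => by
      simpa only [smul_eq_mul, mul_assoc] using hfsmul ℝ _ (hfsmul ℝ w hwi j) i)
    (hfsmul _ z hzi)
    (by
      refine ContinuousOn.intervalIntegrable_of_Icc hab.le ?_
      exact (hwc.inv₀ fun u => (hwpos u).ne').continuousOn.mul
        ((B.continuous.comp_continuousOn hz).clm_apply hz))
    (fun i j hij => by
      rcases lt_or_gt_of_ne hij with h | h
      · rw [← hlt i j h]; congr 1; ext u; ring
      · rw [← hlt j i h]; congr 1; ext u; ring)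
    (fun i => by
      fin_cases i
      · simp [f, hq0]
      · simp [f, hq1, sq]
      · simp [f, hq2, sq]
      · simpa [f, mul_assoc] using hO33)
  have hleft : ∫ u in a..b, (w u)⁻¹ * B (z u) (z u) =
      ∫ u in a..b, Real.exp (2*k*(u-b)) * (z u ⬝ᵥ R *ᵥ z u) := by
    congr 1
    ext u
    rw [hw, Real.exp_neg, inv_inv, hB]
  rw [hleft, Fin.sum_univ_four] at hbessel
  simp only [f, Matrix.cons_val, one_smul, hΩ1', hΩ2', hΩ3', ← hΩ0, hB] at hbessel
  simpa only [one_div] using hbessel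
end

section
/- Let n be a positive integer, R an n×n real symmetric positive definite matrix, a<b reals, and z:[a,b]→ℝⁿ a continuous function. Define ω₀ = ∫_a^b z(u)du, ω₁ = ∫_a^b z(u)du − (2/(b−a))∫_a^b∫_s^b z(u)du ds, ω₂ = ∫_a^b z(u)du − (6/(b−a))∫_a^b∫_s^b z(u)du ds + (12/(b−a)²)∫_a^b∫_s^b∫_v^b z(u)du dv ds, and ω₃ = ∫_a^{(a+b)/2} z(u)du − ∫_{(a+b)/2}^b z(u)du. Then ∫_a^b z(u)ᵀRz(u)du ≥ (1/(b−a))ω₀ᵀRω₀ + (3/(b−a))ω₁ᵀRω₁ + (5/(b−a))ω₂ᵀRω₂ + (1/(b−a))(ω₃ − (3/2)ω₁)ᵀR(ω₃ − (3/2)ω₁). -/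
open Matrix intervalIntegral

/-- Integration by parts against the tail primitive of `f`. -/
theorem integral_deriv_smul_tail_integral {E : Type*} [NormedAddCommGroup E] [NormedSpace ℝ E]
    [CompleteSpace E] {a b : ℝ} (hab : a ≤ b) {f : ℝ → E} (hf : ContinuousOn f (Set.Icc a b))
    {g g' : ℝ → ℝ} (hg : ∀ x, HasDerivAt g (g' x) x) (hg' : Continuous g') (hga : g a = 0) :
    ∫ s in a..b, g' s • ∫ u in s..b, f u = ∫ u in a..b, g u • f u := by
  have hI : IntervalIntegrable f MeasureTheory.volume a b :=
    hf.intervalIntegrable_of_Icc hab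
  have hF : ContinuousOn (fun s => ∫ u in s..b, f u) (Set.uIcc a b) := by
    apply continuousOn_primitive_interval_left
    rw [Set.uIcc_of_le hab]
    exact hf.integrableOn_Icc
  have hF' : ∀ x ∈ Set.Ioo (min a b) (max a b),
      HasDerivAt (fun s => ∫ u in s..b, f u) (-f x) x := by
    intro x hx
    rw [min_eq_left hab, max_eq_right hab] at hx
    have hfo : ContinuousOn f (Set.Ioo a b) := hf.mono Set.Ioo_subset_Icc_self
    refine integral_hasDerivAt_left ?_ ?_ (hfo.continuousAt (Ioo_mem_nhds hx.1 hx.2))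
    · exact (hf.mono (Set.Icc_subset_Icc_left hx.1.le)).intervalIntegrable_of_Icc hx.2.le
    · exact hfo.stronglyMeasurableAtFilter isOpen_Ioo x hx
  have key := integral_smul_deriv_eq_deriv_smul_of_hasDerivAt
    (fun x _ => (hg x).continuousAt.continuousWithinAt) hF (fun x _ => hg x) hF'
    (hg'.intervalIntegrable a b) hI.neg
  simp only [hga, integral_same, smul_zero, zero_smul, sub_zero, zero_sub, smul_neg,
    integral_neg, neg_inj] at key
  exact key.symm

theorem integral_tail_integral {E : Type*} [NormedAddCommGroup E] [NormedSpace ℝ E]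
    [CompleteSpace E] {a b : ℝ} (hab : a ≤ b) {f : ℝ → E} (hf : ContinuousOn f (Set.Icc a b)) :
    ∫ s in a..b, ∫ u in s..b, f u = ∫ u in a..b, (u - a) • f u := by
  simpa using integral_deriv_smul_tail_integral hab hf (g := fun u => u - a)
    (fun x => (hasDerivAt_id x).sub_const a) continuous_const (sub_self a)

theorem integral_tail_integral_tail_integral {E : Type*} [NormedAddCommGroup E]
    [NormedSpace ℝ E] [CompleteSpace E] {a b : ℝ} (hab : a ≤ b) {f : ℝ → E}
    (hf : ContinuousOn f (Set.Icc a b)) :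
    ∫ s in a..b, ∫ v in s..b, ∫ u in v..b, f u = ∫ u in a..b, ((u - a) ^ 2 / 2) • f u := by
  have hF : ContinuousOn (fun s => ∫ u in s..b, f u) (Set.Icc a b) := by
    rw [← Set.uIcc_of_le hab]
    apply continuousOn_primitive_interval_left
    rw [Set.uIcc_of_le hab]
    exact hf.integrableOn_Icc
  rw [integral_tail_integral hab hF]
  refine integral_deriv_smul_tail_integral hab hf (g := fun u => (u - a) ^ 2 / 2) (fun x => ?_)
    (by fun_prop) (by simp)
  have h := (((hasDerivAt_id x).sub_const a).pow 2).div_const 2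
  simpa using h

/-- Lower bound for `∫ y²` obtained from the nonnegativity of `∫ (y - p)²`, for the quadratic
`p u = p0 + p1 (u - a) + p2 (u - a)²`. -/
theorem integral_sq_ge_of_quadratic {y : ℝ → ℝ} {c d : ℝ} (hcd : c ≤ d)
    (hy : ContinuousOn y (Set.Icc c d)) (a p0 p1 p2 : ℝ) :
    2 * (p0 * (∫ u in c..d, y u) + p1 * (∫ u in c..d, (u - a) * y u)
        + p2 * ∫ u in c..d, (u - a) ^ 2 * y u)
      - ((p0 ^ 2 * (d - a) + p0 * p1 * (d - a) ^ 2 + (p1 ^ 2 + 2 * p0 * p2) * (d - a) ^ 3 / 3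
          + p1 * p2 * (d - a) ^ 4 / 2 + p2 ^ 2 * (d - a) ^ 5 / 5)
        - (p0 ^ 2 * (c - a) + p0 * p1 * (c - a) ^ 2 + (p1 ^ 2 + 2 * p0 * p2) * (c - a) ^ 3 / 3
          + p1 * p2 * (c - a) ^ 4 / 2 + p2 ^ 2 * (c - a) ^ 5 / 5))
      ≤ ∫ u in c..d, y u ^ 2 := by
  have hII : ∀ {f : ℝ → ℝ}, ContinuousOn f (Set.Icc c d) →
      IntervalIntegrable f MeasureTheory.volume c d :=
    fun hf => hf.intervalIntegrable_of_Icc hcd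
  have hnonneg : 0 ≤ ∫ u in c..d, (y u - (p0 + p1 * (u - a) + p2 * (u - a) ^ 2)) ^ 2 :=
    integral_nonneg hcd fun u _ => sq_nonneg _
  have hpoly : ∫ u in c..d, (p0 + p1 * (u - a) + p2 * (u - a) ^ 2) ^ 2 =
      (p0 ^ 2 * (d - a) + p0 * p1 * (d - a) ^ 2 + (p1 ^ 2 + 2 * p0 * p2) * (d - a) ^ 3 / 3
          + p1 * p2 * (d - a) ^ 4 / 2 + p2 ^ 2 * (d - a) ^ 5 / 5)
        - (p0 ^ 2 * (c - a) + p0 * p1 * (c - a) ^ 2 + (p1 ^ 2 + 2 * p0 * p2) * (c - a) ^ 3 / 3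
          + p1 * p2 * (c - a) ^ 4 / 2 + p2 ^ 2 * (c - a) ^ 5 / 5) := by
    refine integral_eq_sub_of_hasDerivAt (f := fun u => p0 ^ 2 * (u - a) + p0 * p1 * (u - a) ^ 2
      + (p1 ^ 2 + 2 * p0 * p2) * (u - a) ^ 3 / 3
      + p1 * p2 * (u - a) ^ 4 / 2 + p2 ^ 2 * (u - a) ^ 5 / 5) (fun x _ => ?_)
      (Continuous.intervalIntegrable (by fun_prop) _ _)
    have h1 : HasDerivAt (fun u : ℝ => u - a) 1 x := (hasDerivAt_id x).sub_const a
    have h := ((((h1.const_mul (p0 ^ 2)).add ((h1.pow 2).const_mul (p0 * p1))).add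
      (((h1.pow 3).const_mul (p1 ^ 2 + 2 * p0 * p2)).div_const 3)).add
      (((h1.pow 4).const_mul (p1 * p2)).div_const 2)).add
      (((h1.pow 5).const_mul (p2 ^ 2)).div_const 5)
    refine h.congr_deriv ?_
    push_cast
    ring
  have hexp : ∫ u in c..d, (y u - (p0 + p1 * (u - a) + p2 * (u - a) ^ 2)) ^ 2 =
      (∫ u in c..d, y u ^ 2) - 2 * (p0 * (∫ u in c..d, y u) + p1 * (∫ u in c..d, (u - a) * y u)
        + p2 * ∫ u in c..d, (u - a) ^ 2 * y u)
      + ∫ u in c..d, (p0 + p1 * (u - a) + p2 * (u - a) ^ 2) ^ 2 := by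
    simp only [← integral_const_mul]
    rw [← integral_add (hII (by fun_prop)) (hII (by fun_prop)),
      ← integral_add (hII (by fun_prop)) (hII (by fun_prop)), ← integral_const_mul,
      ← integral_sub (hII (by fun_prop)) (hII (by fun_prop)),
      ← integral_add (hII (by fun_prop)) (hII (by fun_prop))]
    congr 1
    ext u
    ring
  linarith

/-- The scalar inequality with the sharp constant `4` in front of the last square. -/
theorem integral_sq_ge_auxiliary {y : ℝ → ℝ} {a b : ℝ} (hab : a < b)
    (hy : ContinuousOn y (Set.Icc a b)) {w0 w1 w2 w3 : ℝ}
    (hw0 : w0 = ∫ u in a..b, y u)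
    (hw1 : w1 = (∫ u in a..b, y u) - 2 / (b - a) * ∫ u in a..b, (u - a) * y u)
    (hw2 : w2 = (∫ u in a..b, y u) - 6 / (b - a) * (∫ u in a..b, (u - a) * y u)
      + 12 / (b - a) ^ 2 * ∫ u in a..b, (u - a) ^ 2 / 2 * y u)
    (hw3 : w3 = (∫ u in a..((a + b) / 2), y u) - ∫ u in ((a + b) / 2)..b, y u) :
    1 / (b - a) * w0 ^ 2 + 3 / (b - a) * w1 ^ 2 + 5 / (b - a) * w2 ^ 2
      + 4 / (b - a) * (w3 - 3 / 2 * w1) ^ 2 ≤ ∫ u in a..b, y u ^ 2 := by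
  have ham : a ≤ (a + b) / 2 := by linarith
  have hmb : (a + b) / 2 ≤ b := by linarith
  have hyl : ContinuousOn y (Set.Icc a ((a + b) / 2)) := hy.mono (Set.Icc_subset_Icc_right hmb)
  have hyr : ContinuousOn y (Set.Icc ((a + b) / 2) b) := hy.mono (Set.Icc_subset_Icc_left ham)
  have hsplit : ∀ {g : ℝ → ℝ}, ContinuousOn g (Set.Icc a b) → ∫ u in a..b, g u =
      (∫ u in a..((a + b) / 2), g u) + ∫ u in ((a + b) / 2)..b, g u := fun hg =>
    (integral_add_adjacent_intervals
      ((hg.mono (Set.Icc_subset_Icc_right hmb)).intervalIntegrable_of_Icc ham)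
      ((hg.mono (Set.Icc_subset_Icc_left ham)).intervalIntegrable_of_Icc hmb)).symm
  have hhalf : ∫ u in a..b, (u - a) ^ 2 / 2 * y u = (∫ u in a..b, (u - a) ^ 2 * y u) / 2 := by
    rw [← integral_div]
    congr 1
    ext u
    ring
  rw [hhalf] at hw2
  rw [hsplit (by fun_prop : ContinuousOn (fun u => y u ^ 2) _)]
  rw [hsplit hy] at hw0 hw1 hw2
  rw [hsplit (by fun_prop : ContinuousOn (fun u => (u - a) * y u) _)] at hw1 hw2
  rw [hsplit (by fun_prop : ContinuousOn (fun u => (u - a) ^ 2 * y u) _)] at hw2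
  obtain ⟨L, rfl⟩ : ∃ L, b = a + L := ⟨b - a, by ring⟩
  have hL : L ≠ 0 := by
    rintro rfl
    simp at hab
  have hl := integral_sq_ge_of_quadratic ham hyl a
    ((w0 + 3 * w1 + 5 * w2 + 4 * (w3 - 3 / 2 * w1) * (1 - 3 / 2)) / L)
    ((-6 * w1 - 30 * w2 + 12 * (w3 - 3 / 2 * w1)) / L ^ 2) (30 * w2 / L ^ 3)
  have hr := integral_sq_ge_of_quadratic hmb hyr a
    ((w0 + 3 * w1 + 5 * w2 + 4 * (w3 - 3 / 2 * w1) * (-1 - 3 / 2)) / L)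
    ((-6 * w1 - 30 * w2 + 12 * (w3 - 3 / 2 * w1)) / L ^ 2) (30 * w2 / L ^ 3)
  refine le_trans (le_of_eq ?_) (add_le_add hl hr)
  generalize (∫ u in a..((a + (a + L)) / 2), y u) = M0 at *
  generalize (∫ u in ((a + (a + L)) / 2)..(a + L), y u) = N0 at *
  generalize (∫ u in a..((a + (a + L)) / 2), (u - a) * y u) = M1 at *
  generalize (∫ u in ((a + (a + L)) / 2)..(a + L), (u - a) * y u) = N1 at *
  generalize (∫ u in a..((a + (a + L)) / 2), (u - a) ^ 2 * y u) = M2 at *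
  generalize (∫ u in ((a + (a + L)) / 2)..(a + L), (u - a) ^ 2 * y u) = N2 at *
  have e1 : a + L - a = L := by ring
  have e2 : (a + (a + L)) / 2 - a = L / 2 := by ring
  rw [e1] at hw1 hw2
  rw [e1, e2, sub_self, hw0, hw1, hw2, hw3]
  field_simp
  ring

theorem auxiliary_function_integral_inequality
    {n : ℕ} (hn : 0 < n)
    (a b : ℝ) (hab : a < b)
    (R : Matrix (Fin n) (Fin n) ℝ) (hR : R.PosDef)
    (z : ℝ → Fin n → ℝ) (hz : ContinuousOn z (Set.Icc a b))
    (ω0 ω1 ω2 ω3 : Fin n → ℝ)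
    (hω0 : ω0 = ∫ u in a..b, z u)
    (hω1 : ω1 = (∫ u in a..b, z u)
        - (2/(b-a)) • (∫ s in a..b, ∫ u in s..b, z u))
    (hω2 : ω2 = (∫ u in a..b, z u)
        - (6/(b-a)) • (∫ s in a..b, ∫ u in s..b, z u)
        + (12/(b-a)^2) • (∫ s in a..b, ∫ v in s..b, ∫ u in v..b, z u))
    (hω3 : ω3 = (∫ u in a..((a+b)/2), z u) - ∫ u in ((a+b)/2)..b, z u) :
    (∫ u in a..b, z u ⬝ᵥ R *ᵥ z u) ≥
      (1/(b-a)) * (ω0 ⬝ᵥ R *ᵥ ω0) + (3/(b-a)) * (ω1 ⬝ᵥ R *ᵥ ω1) +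
      (5/(b-a)) * (ω2 ⬝ᵥ R *ᵥ ω2) +
      (1/(b-a)) * ((ω3 - (3/2 : ℝ) • ω1) ⬝ᵥ R *ᵥ (ω3 - (3/2 : ℝ) • ω1)) := by
  have hle := hab.le
  obtain ⟨B, rfl⟩ : ∃ B : Matrix (Fin n) (Fin n) ℝ, R = Bᵀ * B := by
    open scoped MatrixOrder Matrix.Norms.L2Operator in
    obtain ⟨B, hB⟩ := CStarAlgebra.nonneg_iff_eq_star_mul_self.mp hR.posSemidef.nonneg
    exact ⟨B, by simpa [star_eq_conjTranspose] using hB⟩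
  have hquad : ∀ x : Fin n → ℝ, x ⬝ᵥ (Bᵀ * B) *ᵥ x = ∑ k, (B *ᵥ x) k ^ 2 := by
    intro x
    rw [← mulVec_mulVec, dotProduct_mulVec, vecMul_transpose]
    simp [dotProduct, sq]
  rw [integral_tail_integral hle hz] at hω1 hω2
  rw [integral_tail_integral_tail_integral hle hz] at hω2
  let φ : Fin n → (Fin n → ℝ) →L[ℝ] ℝ := fun k =>
    (ContinuousLinearMap.proj k).comp (LinearMap.toContinuousLinearMap (mulVecLin B))
  have hφ : ∀ k x, (B *ᵥ x) k = φ k x := fun _ _ => rfl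
  have hφz : ∀ k, ContinuousOn (fun u => φ k (z u)) (Set.Icc a b) := fun k =>
    (φ k).continuous.comp_continuousOn hz
  have hφzsq : ∀ k, ContinuousOn (fun u => φ k (z u) ^ 2) (Set.Icc a b) := fun k =>
    (hφz k).pow 2
  simp only [hquad, hφ]
  rw [integral_finsetSum fun k _ => (hφzsq k).intervalIntegrable_of_Icc hle]
  simp only [Finset.mul_sum, ← Finset.sum_add_distrib]
  refine Finset.sum_le_sum fun k _ => ?_
  have hcomm : ∀ {g : ℝ → ℝ} {c d : ℝ}, Continuous g → a ≤ c → c ≤ d → d ≤ b →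
      φ k (∫ u in c..d, g u • z u) = ∫ u in c..d, g u * φ k (z u) := by
    intro g c d hg hac hcd hdb
    have hgz : ContinuousOn (fun u => g u • z u) (Set.Icc c d) :=
      hg.continuousOn.smul (hz.mono (Set.Icc_subset_Icc hac hdb))
    rw [← (φ k).intervalIntegral_comp_comm (hgz.intervalIntegrable_of_Icc hcd)]
    simp
  have hcomm_one : ∀ {c d : ℝ}, a ≤ c → c ≤ d → d ≤ b →
      φ k (∫ u in c..d, z u) = ∫ u in c..d, φ k (z u) := fun hac hcd hdb => by
    simpa using hcomm (g := fun _ => 1) continuous_const hac hcd hdb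
  have h0 := hcomm_one le_rfl hle le_rfl
  have key := integral_sq_ge_auxiliary (w0 := φ k ω0) (w1 := φ k ω1) (w2 := φ k ω2)
    (w3 := φ k ω3) hab (hφz k)
    (by rw [hω0, h0])
    (by rw [hω1, map_sub, map_smul, h0, hcomm (by fun_prop) le_rfl hle le_rfl, smul_eq_mul])
    (by rw [hω2, map_add, map_sub, map_smul, map_smul, h0,
          hcomm (by fun_prop) le_rfl hle le_rfl, hcomm (by fun_prop) le_rfl hle le_rfl,
          smul_eq_mul, smul_eq_mul])
    (by rw [hω3, map_sub, hcomm_one le_rfl (by linarith) (by linarith),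
          hcomm_one (by linarith) (by linarith) le_rfl])
  have hcoef : 1 / (b - a) * (φ k ω3 - 3 / 2 * φ k ω1) ^ 2 ≤
      4 / (b - a) * (φ k ω3 - 3 / 2 * φ k ω1) ^ 2 := by
    have := sub_pos.mpr hab
    gcongr
    norm_num
  simp only [map_sub, map_smul, smul_eq_mul]
  linarith
end

section
/- Let n be a positive integer, R an n×n real symmetric positive definite matrix, a<b reals, and x:[a,b]→ℝⁿ a continuously differentiable function. Define Ω₇ = x(a) − (1/(b−a))∫_a^b x(u)du and Ω₈ = x(a) − (4/(b−a))∫_a^b x(u)du + (6/(b−a)²)∫_a^b∫_s^b x(u)du ds. Then −∫_a^b∫_a^s ẋ(u)ᵀRẋ(u)du ds ≤ −2Ω₇ᵀRΩ₇ − 4Ω₈ᵀRΩ₈. -/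
open Matrix intervalIntegral

section

variable {E : Type*} [NormedAddCommGroup E] [NormedSpace ℝ E] {a b : ℝ} {f : ℝ → E}

theorem ContinuousOn.hasDerivAt_integral_Ioo [CompleteSpace E]
    (hf : ContinuousOn f (Set.Icc a b)) {s : ℝ} (hs : s ∈ Set.Ioo a b) :
    HasDerivAt (fun t => ∫ u in a..t, f u) (f s) s := by
  refine integral_hasDerivAt_right ?_ ?_ (hf.continuousAt (Icc_mem_nhds hs.1 hs.2))
  · refine ContinuousOn.intervalIntegrable_of_Icc hs.1.le (hf.mono ?_)
    exact Set.Icc_subset_Icc_right hs.2.le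
  · exact (hf.mono Set.Ioo_subset_Icc_self).stronglyMeasurableAtFilter isOpen_Ioo s hs

theorem ContinuousOn.continuousOn_integral_Icc (hab : a ≤ b)
    (hf : ContinuousOn f (Set.Icc a b)) :
    ContinuousOn (fun t => ∫ u in a..t, f u) (Set.Icc a b) := by
  rw [← Set.uIcc_of_le hab] at hf ⊢
  exact continuousOn_primitive_interval (hf.integrableOn_compact isCompact_uIcc)

theorem ContinuousOn.integral_integral_right_eq [CompleteSpace E] (hab : a ≤ b)
    (hf : ContinuousOn f (Set.Icc a b)) :
    ∫ s in a..b, ∫ u in s..b, f u =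
      (b - a) • (∫ u in a..b, f u) - ∫ s in a..b, ∫ u in a..s, f u := by
  have hcongr : ∫ s in a..b, ∫ u in s..b, f u =
      ∫ s in a..b, ((∫ u in a..b, f u) - ∫ u in a..s, f u) := by
    refine integral_congr fun s hs => ?_
    rw [Set.uIcc_of_le hab] at hs
    refine (integral_interval_sub_left ?_ ?_).symm
    · exact hf.intervalIntegrable_of_Icc hab
    · exact (hf.mono (Set.Icc_subset_Icc_right hs.2)).intervalIntegrable_of_Icc hs.1
  rw [hcongr, integral_sub intervalIntegrable_const
    ((hf.continuousOn_integral_Icc hab).intervalIntegrable_of_Icc hab), integral_const]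

/-- The bilinear form version of the inequality: the right-hand side is the squared norm of the
projection of `x'` onto affine functions of `u` for the weight `b - u` on `[a, b]`. -/
theorem two_mul_add_four_mul_le_integral_integral [CompleteSpace E] (hab : a < b)
    (B : E →L[ℝ] E →L[ℝ] ℝ) (hsymm : ∀ v w, B v w = B w v) (hnonneg : ∀ v, 0 ≤ B v v)
    {x x' : ℝ → E} (hderiv : ∀ u ∈ Set.Icc a b, HasDerivAt x (x' u) u)
    (hx' : ContinuousOn x' (Set.Icc a b)) {p q : E}
    (hp : p = x a - (1 / (b - a)) • (∫ u in a..b, x u))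
    (hq : q = x a - (4 / (b - a)) • (∫ u in a..b, x u)
        + (6 / (b - a) ^ 2) • (∫ s in a..b, ∫ u in s..b, x u)) :
    2 * B p p + 4 * B q q ≤ ∫ s in a..b, ∫ u in a..s, B (x' u) (x' u) := by
  have hh : b - a ≠ 0 := (sub_pos.2 hab).ne'
  have hx : ContinuousOn x (Set.Icc a b) := fun u hu =>
    (hderiv u hu).continuousAt.continuousWithinAt
  have hQ : ContinuousOn (fun u => B (x' u) (x' u)) (Set.Icc a b) := by fun_prop
  rw [hx.integral_integral_right_eq hab.le] at hq
  have hX := hx.continuousOn_integral_Icc hab.le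
  have hZ := hX.continuousOn_integral_Icc hab.le
  have hE := hQ.continuousOn_integral_Icc hab.le
  have hG := hE.continuousOn_integral_Icc hab.le
  have hX' := fun s hs => hx.hasDerivAt_integral_Ioo (s := s) hs
  have hZ' := fun s hs => hX.hasDerivAt_integral_Ioo (s := s) hs
  have hE' := fun s hs => hQ.hasDerivAt_integral_Ioo (s := s) hs
  have hG' := fun s hs => hE.hasDerivAt_integral_Ioo (s := s) hs
  have hXa : ∫ u in a..a, x u = 0 := integral_same
  have hZa : ∫ s in a..a, ∫ u in a..s, x u = 0 := integral_same
  have hEa : ∫ u in a..a, B (x' u) (x' u) = 0 := integral_same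
  have hGa : ∫ s in a..a, ∫ u in a..s, B (x' u) (x' u) = 0 := integral_same
  set X : ℝ → E := fun s => ∫ u in a..s, x u
  set Z : ℝ → E := fun s => ∫ r in a..s, X r
  set e : ℝ → ℝ := fun s => ∫ u in a..s, B (x' u) (x' u)
  set G : ℝ → ℝ := fun s => ∫ r in a..s, e r
  change ∀ s ∈ Set.Ioo a b, HasDerivAt Z (X s) s at hZ'
  change ∀ s ∈ Set.Ioo a b, HasDerivAt G (e s) s at hG'
  change p = x a - (1 / (b - a)) • X b at hp
  change q = x a - (4 / (b - a)) • X b + (6 / (b - a) ^ 2) • ((b - a) • X b - Z b) at hq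
  change X a = 0 at hXa
  change Z a = 0 at hZa
  change e a = 0 at hEa
  change G a = 0 at hGa
  change _ ≤ G b
  -- antiderivatives of the moments of `x'` of degrees zero and one
  let P : ℝ → E := fun s => (b - s) • x s + X s
  let S : ℝ → E := fun s => ((b - s) ^ 2 - 2 * (b - a) / 3 * (b - s)) • x s
    + (2 : ℝ) • ((b - s) • X s + Z s) - (2 * (b - a) / 3) • X s
  have hP : P b - P a = -(b - a) • p := by
    simp only [P, hp, hXa]
    match_scalars <;> field_simp <;> ring
  have hS : S b - S a = -((b - a) ^ 2 / 3) • q := by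
    simp only [S, hq, hXa, hZa]
    match_scalars <;> field_simp <;> ring
  have hlin : ∀ s : ℝ, HasDerivAt (fun s => b - s) (-1) s := fun s => by
    simpa using (hasDerivAt_id s).const_sub b
  have hP' : ∀ s ∈ Set.Ioo a b, HasDerivAt P ((b - s) • x' s) s := fun s hs => by
    refine (((hlin s).smul (hderiv s (Set.Ioo_subset_Icc_self hs))).add
      (hX' s hs)).congr_deriv ?_
    module
  have hS' : ∀ s ∈ Set.Ioo a b,
      HasDerivAt S (((b - s) * (b - s - 2 * (b - a) / 3)) • x' s) s := fun s hs => by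
    refine ((((((hlin s).pow 2).sub ((hlin s).const_mul (2 * (b - a) / 3))).smul
      (hderiv s (Set.Ioo_subset_Icc_self hs))).add
      ((((hlin s).smul (hX' s hs)).add (hZ' s hs)).const_smul (2 : ℝ))).sub
      ((hX' s hs).const_smul (2 * (b - a) / 3))).congr_deriv ?_
    simp only [Pi.sub_apply, Pi.pow_apply]
    module
  let α : E := (-2 / (b - a)) • p
  let β : E := (-12 / (b - a) ^ 2) • q
  let F : ℝ → ℝ := fun s => (b - s) * e s + G s - 2 * B α (P s) - 2 * B β (S s)
    - ((b - s) ^ 2 / 2) * B α α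
    - 2 * ((b - s) ^ 3 / 3 - (b - a) * (b - s) ^ 2 / 3) * B α β
    - ((b - s) ^ 4 / 4 - 4 * (b - a) / 9 * (b - s) ^ 3
      + 2 * (b - a) ^ 2 / 9 * (b - s) ^ 2) * B β β
  have hF' : ∀ s ∈ Set.Ioo a b, HasDerivAt F ((b - s) *
      B (x' s - α - (b - s - 2 * (b - a) / 3) • β)
        (x' s - α - (b - s - 2 * (b - a) / 3) • β)) s := fun s hs => by
    have h2 := ((hlin s).pow 2).div_const 2
    have h3 := ((((hlin s).pow 3).div_const 3).sub
      ((((hlin s).pow 2).const_mul (b - a)).div_const 3)).const_mul 2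
    have h4 := ((((hlin s).pow 4).div_const 4).sub
      (((hlin s).pow 3).const_mul (4 * (b - a) / 9))).add
      (((hlin s).pow 2).const_mul (2 * (b - a) ^ 2 / 9))
    have hBP := ((B α).hasFDerivAt.comp_hasDerivAt s (hP' s hs)).const_mul 2
    have hBS := ((B β).hasFDerivAt.comp_hasDerivAt s (hS' s hs)).const_mul 2
    refine ((((((((hlin s).mul (hE' s hs)).add (hG' s hs)).sub hBP).sub hBS).sub
      (h2.mul_const (B α α))).sub (h3.mul_const (B α β))).sub (h4.mul_const (B β β))).congr_deriv ?_
    simp only [map_sub, map_smul, _root_.sub_apply, _root_.smul_apply,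
      smul_eq_mul, hsymm (x' s) α, hsymm (x' s) β, hsymm β α]
    push_cast
    ring
  have hF : ContinuousOn F (Set.Icc a b) := by fun_prop
  have hmono : MonotoneOn F (Set.Icc a b) := by
    refine monotoneOn_of_deriv_nonneg (convex_Icc a b) hF ?_ ?_ <;> rw [interior_Icc]
    · exact fun s hs => (hF' s hs).differentiableAt.differentiableWithinAt
    · intro s hs
      rw [(hF' s hs).deriv]
      exact mul_nonneg (sub_pos.2 hs.2).le (hnonneg _)
  have hle : F a ≤ F b :=
    hmono (Set.left_mem_Icc.2 hab.le) (Set.right_mem_Icc.2 hab.le) hab.le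
  rw [sub_eq_iff_eq_add] at hP hS
  simp only [F, hP, hS, hEa, hGa, map_add, α, β, map_smul, _root_.smul_apply,
    smul_eq_mul] at hle
  rw [← sub_nonneg] at hle ⊢
  convert hle using 1
  field_simp
  ring

end

theorem double_integral_inequality_lower
    {n : ℕ} (hn : 0 < n)
    (a b : ℝ) (hab : a < b)
    (R : Matrix (Fin n) (Fin n) ℝ) (hR : R.PosDef)
    (x x' : ℝ → Fin n → ℝ)
    (hderiv : ∀ u ∈ Set.Icc a b, HasDerivAt x (x' u) u)
    (hx' : ContinuousOn x' (Set.Icc a b))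
    (Ω7 Ω8 : Fin n → ℝ)
    (hΩ7 : Ω7 = x a - (1/(b-a)) • (∫ u in a..b, x u))
    (hΩ8 : Ω8 = x a - (4/(b-a)) • (∫ u in a..b, x u)
        + (6/(b-a)^2) • (∫ s in a..b, ∫ u in s..b, x u)) :
    -(∫ s in a..b, ∫ u in a..s, x' u ⬝ᵥ R *ᵥ x' u) ≤
      -(2 * (Ω7 ⬝ᵥ R *ᵥ Ω7)) - 4 * (Ω8 ⬝ᵥ R *ᵥ Ω8) := by
  let B : (Fin n → ℝ) →L[ℝ] (Fin n → ℝ) →L[ℝ] ℝ :=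
    LinearMap.toContinuousBilinearMap (Matrix.toLinearMap₂' ℝ R)
  have hB : ∀ v w, B v w = v ⬝ᵥ R *ᵥ w := fun v w => Matrix.toLinearMap₂'_apply' R v w
  have hsymm : ∀ v w, B v w = B w v := fun v w => by
    have hT : Rᵀ = R := by simpa using hR.isHermitian.eq
    rw [hB, hB, dotProduct_mulVec, ← mulVec_transpose, hT, dotProduct_comm]
  have hnonneg : ∀ v, 0 ≤ B v v := fun v => by
    simpa [hB] using hR.posSemidef.dotProduct_mulVec_nonneg v
  have h := two_mul_add_four_mul_le_integral_integral hab B hsymm hnonneg hderiv hx' hΩ7 hΩ8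
  simp only [hB] at h
  linarith
end

section
/- Let N≥1 and let f₁,…,f_N be positive reals, α₁,…,α_N positive reals with Σᵢ αᵢ = 1, and for each pair i≠j let g_{ij} be reals with g_{ij}=g_{ji} such that each 2×2 matrix [[fᵢ, g_{ij}],[g_{ij}, fⱼ]] is positive semidefinite. Then Σᵢ (1/αᵢ)ated fᵢ ≥ Σᵢ fᵢ + Σ_{i≠j} g_{ij}; that is, Σᵢ (1/αᵢ)fᵢ − Σᵢ fᵢ − Σ_{i≠j} g_{ij} ≥ 0. -/
open Matrix Finset

/-- The quadratic form of a positive semidefinite `2 × 2` matrix, evaluated at `(y, -x)`. -/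
lemma two_mul_mul_mul_le_of_posSemidef {a b c : ℝ} (h : (!![a, b; b, c]).PosSemidef) (x y : ℝ) :
    2 * (x * y * b) ≤ y ^ 2 * a + x ^ 2 * c := by
  have := h.dotProduct_mulVec_nonneg ![y, -x]
  simp [Matrix.mulVec, dotProduct, Fin.sum_univ_two] at this
  nlinarith

lemma two_mul_le_div_mul_add_div_mul_of_posSemidef {a b c x y : ℝ}
    (h : (!![a, b; b, c]).PosSemidef) (hx : 0 < x) (hy : 0 < y) :
    2 * b ≤ y / x * a + x / y * c := by
  have hxy : y / x * a + x / y * c = (y ^ 2 * a + x ^ 2 * c) / (x * y) := by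
    field_simp
  rw [hxy, le_div_iff₀ (mul_pos hx hy)]
  linarith [two_mul_mul_mul_le_of_posSemidef h x y]

theorem reciprocally_convex_lower_bound
    (N : ℕ) (hN : 1 ≤ N)
    (f α : Fin N → ℝ) (g : Fin N → Fin N → ℝ)
    (hf : ∀ i, 0 < f i)
    (hα : ∀ i, 0 < α i)
    (hαsum : ∑ i, α i = 1)
    (hgsymm : ∀ i j, i ≠ j → g i j = g j i)
    (hpsd : ∀ i j, i ≠ j → (!![f i, g i j; g i j, f j]).PosSemidef) :
    ∑ i, (1 / α i) * f i ≥
      (∑ i, f i) + ∑ i, ∑ j, (if i ≠ j then g i j else 0) := by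
  have hlhs : ∑ i, (1 / α i) * f i = ∑ i, ∑ j, α j / α i * f i := by
    refine sum_congr rfl fun i _ => ?_
    rw [← sum_mul, ← sum_div, hαsum]
  have hswap : ∑ i, ∑ j, α i / α j * f j = ∑ i, ∑ j, α j / α i * f i := sum_comm
  have hrhs : (∑ i, f i) + ∑ i, ∑ j, (if i ≠ j then g i j else 0) =
      ∑ i, ∑ j, ((if i = j then f i else 0) + if i ≠ j then g i j else 0) := by
    simp [sum_add_distrib]
  have hpair : ∑ i, ∑ j, 2 * ((if i = j then f i else 0) + if i ≠ j then g i j else 0) ≤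
      ∑ i, ∑ j, (α j / α i * f i + α i / α j * f j) := by
    refine sum_le_sum fun i _ => sum_le_sum fun j _ => ?_
    by_cases hij : i = j
    · subst hij
      simp [div_self (hα i).ne', two_mul]
    · simpa [hij] using
        two_mul_le_div_mul_add_div_mul_of_posSemidef (hpsd i j hij) (hα i) (hα j)
  simp only [← mul_sum] at hpair
  rw [← hrhs] at hpair
  simp only [sum_add_distrib] at hpair
  rw [hswap, ← hlhs] at hpair
  linarith
end

section
/- Let n be a positive integer, Z₁ and Z₂ real symmetric positive definite n×n matrices, and S a real n×n matrix such that the 2n×2n block matrix [[Z₁, S],[Sᵀ, Z₂]] is positive semidefinite. Then for every α with 0<α<1 and all vectors x,y∈ℝⁿ, (1/α)xᵀZ₁x + (1/(1−α))yᵀZ₂y ≥ xᵀZ₁x + yᵀZ₂y + 2xᵀSy. -/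
open Matrix

/-- The quadratic form of a real positive semidefinite block matrix, evaluated at `(x, y)`. -/
lemma Matrix.PosSemidef.fromBlocks_quadratic_nonneg {m n : Type*} [Fintype m] [Fintype n]
    {A : Matrix m m ℝ} {B : Matrix m n ℝ} {D : Matrix n n ℝ}
    (h : (Matrix.fromBlocks A B Bᵀ D).PosSemidef) (x : m → ℝ) (y : n → ℝ) :
    0 ≤ x ⬝ᵥ A *ᵥ x + y ⬝ᵥ D *ᵥ y + 2 * (x ⬝ᵥ B *ᵥ y) := by
  have hq := h.dotProduct_mulVec_nonneg (Sum.elim x y)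
  have hB : y ⬝ᵥ Bᵀ *ᵥ x = x ⬝ᵥ B *ᵥ y := by
    rw [mulVec_transpose, dotProduct_comm, ← dotProduct_mulVec]
  rw [star_trivial, fromBlocks_mulVec, sumElim_dotProduct_sumElim, Sum.elim_comp_inl,
    Sum.elim_comp_inr, dotProduct_add, dotProduct_add, hB] at hq
  linarith

theorem reciprocally_convex_matrix_bound
    {n : ℕ} (hn : 0 < n)
    (Z1 Z2 S : Matrix (Fin n) (Fin n) ℝ)
    (hZ1 : Z1.PosDef) (hZ2 : Z2.PosDef)
    (hblock : (Matrix.fromBlocks Z1 S Sᵀ Z2).PosSemidef)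
    (α : ℝ) (hα0 : 0 < α) (hα1 : α < 1)
    (x y : Fin n → ℝ) :
    (1/α) * (x ⬝ᵥ Z1 *ᵥ x) + (1/(1-α)) * (y ⬝ᵥ Z2 *ᵥ y) ≥
      x ⬝ᵥ Z1 *ᵥ x + y ⬝ᵥ Z2 *ᵥ y + 2 * (x ⬝ᵥ S *ᵥ y) := by
  have hβ : 0 < 1 - α := sub_pos.mpr hα1
  have hq := hblock.fromBlocks_quadratic_nonneg ((1 - α) • x) ((-α) • y)
  simp only [mulVec_smul, dotProduct_smul, smul_dotProduct, smul_eq_mul] at hq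
  rw [ge_iff_le, ← sub_nonneg]
  refine (div_nonneg hq (mul_pos hα0 hβ).le).trans_eq ?_
  field_simp
  ring
end
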